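/- If H is a graph and h is an edge of H such that H − h is planar and triangle-free, then H is 3-colorable. -/

import Mathlib

universe u
variable {V : Type u}



/-- A topological embedding (drawing) of a simple graph in a topological space `X`:
vertices map to distinct points, edges map to arcs meeting only at common endpoints. -/
structure GraphEmbeddingIn (X : Type*) [TopologicalSpace X] (G : SimpleGraph V) where
  vertexPos : V → X
  vertexInj : Function.Injective vertexPos
  edgeArc : ∀ u v : V, G.Adj u v → ℝ → X
  arc_cont : ∀ u v h, ContinuousOn (edgeArc u v h) (Set.Icc 0 1)
  arc_injOn : ∀ u v h, Set.InjOn (edgeArc u v h) (Set.Icc 0 1)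
  arc_start : ∀ u v h, edgeArc u v h 0 = vertexPos u
  arc_end : ∀ u v h, edgeArc u v h 1 = vertexPos v
  arc_avoid : ∀ u v h (w : V), vertexPos w ∉ edgeArc u v h '' Set.Ioo 0 1
  arc_disjoint : ∀ u v h u' v' h', s(u, v) ≠ s(u', v') →
    edgeArc u v h '' Set.Ioo 0 1 ∩ edgeArc u' v' h' '' Set.Icc 0 1 = ∅

/-- A graph is planar if it has a drawing in the plane. -/
def SimpleGraph.IsPlanar (G : SimpleGraph V) : Prop :=
  Nonempty (GraphEmbeddingIn (ℝ × ℝ) G)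

namespace Grotzsch

section Potential

open Finset Classical

/-- `G` restricted to the vertices of `R` has a proper 3-coloring. -/
def ColOn (G : SimpleGraph V) (R : Finset V) : Prop :=
  ∃ c : V → Fin 3, ∀ a ∈ R, ∀ b ∈ R, G.Adj a b → c a ≠ c b

/-- The darts (ordered adjacent pairs) of `G` inside `R`. -/
noncomputable def darts (G : SimpleGraph V) (R : Finset V) : Finset (V × V) :=
  (R ×ˢ R).filter fun p => G.Adj p.1 p.2

/-- Twice the Kostochka–Yancey potential `5 |R| - 3 e(R)`. -/
noncomputable def pot (G : SimpleGraph V) (R : Finset V) : ℤ :=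
  10 * (#R : ℤ) - 3 * (#(darts G R) : ℤ)

lemma mem_darts {G : SimpleGraph V} {R : Finset V} {p : V × V} :
    p ∈ darts G R ↔ p.1 ∈ R ∧ p.2 ∈ R ∧ G.Adj p.1 p.2 := by
  simp [darts, and_assoc]

lemma darts_card_eq_sum (G : SimpleGraph V) (R : Finset V) :
    #(darts G R) = ∑ a ∈ R, #(R.filter (G.Adj a)) := by
  simp only [darts, card_filter, sum_product]

lemma offDiag_card_eq_mul {α : Type*} (s : Finset α) : #s.offDiag = #s * (#s - 1) := by
  rw [offDiag_card, Nat.mul_sub, mul_one]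

lemma darts_card_le (G : SimpleGraph V) (R : Finset V) :
    #(darts G R) ≤ #R * (#R - 1) := by
  rw [← offDiag_card_eq_mul R]
  refine card_le_card fun p hp => ?_
  rw [mem_darts] at hp
  simp [hp.1, hp.2.1, hp.2.2.ne]

lemma four_le_card_of_not_colOn {G : SimpleGraph V} {R : Finset V} (h : ¬ ColOn G R) :
    4 ≤ #R := by
  by_contra hlt
  apply h
  have : Fintype.card R ≤ Fintype.card (Fin 3) := by simp; omega
  obtain ⟨f⟩ := Function.Embedding.nonempty_of_card_le this
  refine ⟨fun v => if hv : v ∈ R then f ⟨v, hv⟩ else 0, fun a ha b hb hab => ?_⟩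
  simp only [ha, hb, dif_pos]
  intro heq
  have := f.injective heq
  simp only [Subtype.mk.injEq] at this
  exact hab.ne this

lemma ColOn.insert_of_card {G : SimpleGraph V} {R : Finset V} {v : V} {c : V → Fin 3}
    (hc : ∀ a ∈ R, ∀ b ∈ R, G.Adj a b → c a ≠ c b)
    (hv : #((R.filter (G.Adj v)).image c) ≤ 2) :
    ∃ k, ∀ a ∈ insert v R, ∀ b ∈ insert v R, G.Adj a b →
      Function.update c v k a ≠ Function.update c v k b := by
  have hlt : #((R.filter (G.Adj v)).image c) < #(univ : Finset (Fin 3)) := by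
    simp only [card_univ, Fintype.card_fin]; omega
  obtain ⟨k, -, hk⟩ := exists_mem_notMem_of_card_lt_card hlt
  have key : ∀ b ∈ R, G.Adj v b → c b ≠ k := fun b hb hvb h =>
    hk (mem_image.2 ⟨b, by simp [hb, hvb], h⟩)
  refine ⟨k, fun a ha b hb hab => ?_⟩
  rw [mem_insert] at ha hb
  by_cases hav : a = v
  · subst hav
    have hba : b ≠ a := hab.ne'
    rw [Function.update_self, Function.update_of_ne hba]
    exact (key b (hb.resolve_left hba) hab).symm
  · by_cases hbv : b = v
    · subst hbv
      rw [Function.update_self, Function.update_of_ne hav]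
      exact key a (ha.resolve_left hav) hab.symm
    · rw [Function.update_of_ne hav, Function.update_of_ne hbv]
      exact hc a (ha.resolve_left hav) b (hb.resolve_left hbv) hab

/-- The inductive hypothesis of the Kostochka–Yancey theorem below `n` vertices. -/
def KYBelow (V : Type u) (n : ℕ) : Prop :=
  ∀ (G : SimpleGraph V) (U : Finset V), #U < n → ¬ ColOn G U →
    ∃ R ⊆ U, ¬ ColOn G R ∧ pot G R ≤ 4

/-- Every proper subset of `U` is 3-colorable, but `U` is not. -/
structure Crit (G : SimpleGraph V) (U : Finset V) : Prop where
  not_col : ¬ ColOn G U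
  col : ∀ R ⊂ U, ColOn G R

lemma exists_collapse {G : SimpleGraph V} {U R : Finset V} (hU : Crit G U)
    (ih : KYBelow V #U) (hR : R ⊆ U) (hR4 : 4 ≤ #R) {c : V → Fin 3}
    (hc : ∀ a ∈ R, ∀ b ∈ R, G.Adj a b → c a ≠ c b) :
    ∃ T ⊆ U \ R, ∃ X : Finset (Fin 3), X.Nonempty ∧
      10 * (#T : ℤ) + 10 * #X - 3 * (#X * (#X - 1) : ℕ) ≤
        4 + 3 * #((darts G (T ∪ R)).filter fun p => ¬ (p.1 ∈ R ∧ p.2 ∈ R) ∧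
          (p.1 ∈ R → c p.1 ∈ X) ∧ (p.2 ∈ R → c p.2 ∈ X)) := by
  have h3 : Fintype.card (Fin 3) ≤ Fintype.card R := by simp; omega
  obtain ⟨x⟩ := Function.Embedding.nonempty_of_card_le h3
  let f : V → V := fun v => if v ∈ R then (x (c v) : V) else v
  have fR : ∀ v ∈ R, f v = x (c v) := fun v hv => by simp [f, hv]
  have fN : ∀ v, v ∉ R → f v = v := fun v hv => by simp [f, hv]
  have xinj : ∀ {i j}, (x i : V) = x j → i = j := fun h => x.injective (Subtype.ext h)
  let Y : SimpleGraph V := SimpleGraph.fromRel fun u v =>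
    (∃ a ∈ U, ∃ b ∈ U, G.Adj a b ∧ f a = u ∧ f b = v) ∨
      ((∃ i, (x i : V) = u) ∧ ∃ j, (x j : V) = v)
  have hY : ∀ {u v}, Y.Adj u v ↔ u ≠ v ∧ ((∃ a ∈ U, ∃ b ∈ U, G.Adj a b ∧ f a = u ∧ f b = v) ∨
      ((∃ i, (x i : V) = u) ∧ ∃ j, (x j : V) = v)) := by
    intro u v
    simp only [Y, SimpleGraph.fromRel_adj]
    refine and_congr_right fun _ => ⟨?_, Or.inl⟩
    rintro (h | h | h)
    · exact h
    · obtain ⟨a, ha, b, hb, hab, h1, h2⟩ := h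
      exact Or.inl ⟨b, hb, a, ha, hab.symm, h2, h1⟩
    · exact Or.inr ⟨h.2, h.1⟩
  let X0 : Finset V := univ.image fun i => (x i : V)
  have hX0 : #X0 = 3 := by
    rw [card_image_of_injective _ fun i j h => xinj h]; simp
  have hX0R : X0 ⊆ R := by
    intro v hv
    obtain ⟨i, -, rfl⟩ := mem_image.1 hv
    exact (x i).2
  let U' := (U \ R) ∪ X0
  have hU' : #U' < #U := by
    have h1 : #U' ≤ #(U \ R) + #X0 := card_union_le _ _
    have h2 := card_sdiff_add_card_eq_card hR
    omega
  have fU' : ∀ a ∈ U, f a ∈ U' := by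
    intro a ha
    by_cases haR : a ∈ R
    · rw [fR a haR]
      exact mem_union_right _ (mem_image.2 ⟨_, mem_univ _, rfl⟩)
    · rw [fN a haR]
      exact mem_union_left _ (by simp [ha, haR])
  have fne : ∀ a b, G.Adj a b → f a ≠ f b := by
    intro a b hab
    by_cases haR : a ∈ R <;> by_cases hbR : b ∈ R
    · rw [fR a haR, fR b hbR]
      exact fun h => hc a haR b hbR hab (xinj h)
    · rw [fR a haR, fN b hbR]
      exact fun h => hbR (h ▸ (x (c a)).2)
    · rw [fN a haR, fR b hbR]
      exact fun h => haR (h ▸ (x (c b)).2)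
    · rw [fN a haR, fN b hbR]
      exact hab.ne
  have hYcol : ¬ ColOn Y U' := by
    rintro ⟨k, hk⟩
    exact hU.not_col ⟨k ∘ f, fun a ha b hb hab => hk _ (fU' a ha) _ (fU' b hb)
      (hY.2 ⟨fne a b hab, Or.inl ⟨a, ha, b, hb, hab, rfl, rfl⟩⟩)⟩
  obtain ⟨R1, hR1U, hR1c, hR1p⟩ := ih Y U' hU' hYcol
  let T := R1 \ R
  let X := univ.filter fun i => (x i : V) ∈ R1
  have hTU : T ⊆ U \ R := by
    intro v hv
    simp only [T, mem_sdiff] at hv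
    rcases mem_union.1 (hR1U hv.1) with h | h
    · exact h
    · exact absurd (hX0R h) hv.2
  have hcard : #R1 = #T + #X := by
    have h1 : #(R1 ∩ R) = #X := by
      have : R1 ∩ R = X.image fun i => (x i : V) := by
        ext v
        simp only [mem_inter, mem_image, X, mem_filter, mem_univ, true_and]
        constructor
        · rintro ⟨h1, h2⟩
          rcases mem_union.1 (hR1U h1) with h | h
          · simp [h2] at h
          · obtain ⟨i, -, rfl⟩ := mem_image.1 h
            exact ⟨i, h1, rfl⟩
        · rintro ⟨i, hi, rfl⟩
          exact ⟨hi, (x i).2⟩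
      rw [this, card_image_of_injective _ fun i j h => xinj h]
    have h2 := card_sdiff_add_card_inter R1 R
    simp only [T]; omega
  refine ⟨T, hTU, X, ?_, ?_⟩
  · by_contra hXe
    rw [not_nonempty_iff_eq_empty] at hXe
    have hR1R : ∀ v ∈ R1, v ∈ U \ R := by
      intro v hv
      rcases mem_union.1 (hR1U hv) with h | h
      · exact h
      · obtain ⟨i, -, rfl⟩ := mem_image.1 h
        have : i ∈ X := by simp [X, hv]
        simp [hXe] at this
    have hss : R1 ⊂ U := by
      refine ⟨fun v hv => (mem_sdiff.1 (hR1R v hv)).1, fun h => ?_⟩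
      obtain ⟨v, hv⟩ : R.Nonempty := card_pos.1 (by omega)
      exact (mem_sdiff.1 (hR1R v (h (hR hv)))).2 hv
    obtain ⟨k, hk⟩ := hU.col R1 hss
    refine hR1c ⟨k, fun a ha b hb hab => hk a ha b hb ?_⟩
    have haN := (mem_sdiff.1 (hR1R a ha)).2
    have hbN := (mem_sdiff.1 (hR1R b hb)).2
    rcases (hY.1 hab).2 with ⟨a', -, b', -, h, h1, h2⟩ | ⟨⟨i, hi⟩, -⟩
    · have ha' : a' ∉ R := fun h' => haN (by rw [← h1, fR a' h']; exact (x _).2)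
      have hb' : b' ∉ R := fun h' => hbN (by rw [← h2, fR b' h']; exact (x _).2)
      rw [fN a' ha'] at h1
      rw [fN b' hb'] at h2
      rwa [← h1, ← h2]
    · exact absurd (hi ▸ (x i).2) haN
  · set P := (darts G (T ∪ R)).filter fun p => ¬ (p.1 ∈ R ∧ p.2 ∈ R) ∧
          (p.1 ∈ R → c p.1 ∈ X) ∧ (p.2 ∈ R → c p.2 ∈ X) with hP
    have hd : #(darts Y R1) ≤ #P + #X * (#X - 1) := by
      rw [← offDiag_card_eq_mul X]
      have hsub : darts Y R1 ⊆ P.image (Prod.map f f) ∪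
          X.offDiag.image (Prod.map (fun i => (x i : V)) fun i => (x i : V)) := by
        rintro ⟨u, v⟩ huv
        rw [mem_darts] at huv
        obtain ⟨hu, hv, huv⟩ := huv
        simp only at hu hv huv
        by_cases hX : (∃ i, (x i : V) = u) ∧ ∃ j, (x j : V) = v
        · obtain ⟨⟨i, rfl⟩, j, rfl⟩ := hX
          refine mem_union_right _ (mem_image.2 ⟨(i, j), ?_, rfl⟩)
          simp only [mem_offDiag, X, mem_filter, mem_univ, true_and]
          exact ⟨hu, hv, fun h => huv.ne (by rw [h])⟩
        · refine mem_union_left _ (mem_image.2 ?_)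
          obtain ⟨a, ha, b, hb, hab, rfl, rfl⟩ := (hY.1 huv).2.resolve_right hX
          refine ⟨(a, b), ?_, rfl⟩
          have aux : ∀ w, f w ∈ R1 → w ∈ T ∪ R ∧ (w ∈ R → c w ∈ X) := by
            intro w hw
            by_cases hwR : w ∈ R
            · exact ⟨mem_union_right _ hwR, fun _ => by
                rw [fR w hwR] at hw; simp [X, hw]⟩
            · rw [fN w hwR] at hw
              exact ⟨mem_union_left _ (by simp [T, hw, hwR]), fun h => absurd h hwR⟩
          simp only [hP, mem_filter, mem_darts]
          refine ⟨⟨(aux a hu).1, (aux b hv).1, hab⟩, ?_, (aux a hu).2, (aux b hv).2⟩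
          rintro ⟨h1, h2⟩
          exact hX ⟨⟨c a, (fR a h1).symm⟩, ⟨c b, (fR b h2).symm⟩⟩
      exact (card_le_card hsub).trans ((card_union_le _ _).trans
        (add_le_add card_image_le card_image_le))
    unfold pot at hR1p
    have hd' : (#(darts Y R1) : ℤ) ≤ #P + (#X * (#X - 1) : ℕ) := by exact_mod_cast hd
    have hc' : (#R1 : ℤ) = #T + #X := by exact_mod_cast hcard
    linarith

end Potential

section KostochkaYancey

open Finset Classical

lemma darts_mono {G G' : SimpleGraph V} {R R' : Finset V} (hG : G ≤ G') (hR : R ⊆ R') :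
    darts G R ⊆ darts G' R' := by
  intro p hp
  rw [mem_darts] at hp ⊢
  exact ⟨hR hp.1, hR hp.2.1, hG hp.2.2⟩

lemma ten_lt_pot_of_card {G : SimpleGraph V} {R : Finset V} (h2 : 2 ≤ #R) (h3 : #R ≤ 3) :
    10 < pot G R := by
  have := darts_card_le G R
  unfold pot
  obtain h | h : #R = 2 ∨ #R = 3 := by omega
  all_goals rw [h] at this ⊢; push_cast; omega

lemma collapse_pot {G : SimpleGraph V} {R T : Finset V} (hTR : Disjoint T R)
    {P E : Finset (V × V)}
    (hP : P ⊆ darts G (T ∪ R)) (hPR : ∀ p ∈ P, ¬ (p.1 ∈ R ∧ p.2 ∈ R))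
    (hE : E ⊆ darts G (T ∪ R)) (hER : ∀ p ∈ E, ¬ (p.1 ∈ R ∧ p.2 ∈ R))
    (hPE : Disjoint P E) :
    pot G (T ∪ R) ≤ 10 * #T + pot G R - 3 * #P - 3 * #E := by
  have h1 : #(P ∪ E ∪ darts G R) ≤ #(darts G (T ∪ R)) := by
    apply card_le_card
    exact union_subset (union_subset hP hE) (darts_mono le_rfl subset_union_right)
  have h2 : Disjoint (P ∪ E) (darts G R) := by
    rw [disjoint_left]
    intro p hp hpR
    rw [mem_darts] at hpR
    rcases mem_union.1 hp with h | h
    · exact hPR p h ⟨hpR.1, hpR.2.1⟩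
    · exact hER p h ⟨hpR.1, hpR.2.1⟩
  rw [card_union_of_disjoint h2, card_union_of_disjoint hPE] at h1
  unfold pot
  rw [card_union_of_disjoint hTR]
  push_cast
  have : (#P : ℤ) + #E + #(darts G R) ≤ #(darts G (T ∪ R)) := by exact_mod_cast h1
  linarith

lemma card_fin_three_cases {X : Finset (Fin 3)} (hX : X.Nonempty) :
    #X = 1 ∨ #X = 2 ∨ #X = 3 := by
  have h1 := card_pos.2 hX
  have h2 := card_le_univ X
  simp only [Fintype.card_fin] at h2
  omega

lemma ten_lt_pot {G : SimpleGraph V} {U : Finset V} (hU : Crit G U)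
    (ih : KYBelow V #U) (hpot : 4 < pot G U) :
    ∀ R ⊂ U, 2 ≤ #R → 10 < pot G R := by
  intro R₀ hR₀ hR₀2
  by_contra hlt
  obtain ⟨R, hRmem, hRmin⟩ := exists_min_image (U.powerset.filter fun R => R ⊂ U ∧ 2 ≤ #R)
    (pot G) ⟨R₀, by simp [hR₀, hR₀2, hR₀.subset]⟩
  simp only [mem_filter, mem_powerset] at hRmem hRmin
  obtain ⟨-, hRU, hR2⟩ := hRmem
  have hm : pot G R ≤ 10 := by
    have := hRmin R₀ ⟨hR₀.subset, hR₀, hR₀2⟩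
    omega
  have hR4 : 4 ≤ #R := by
    by_contra h
    have := ten_lt_pot_of_card (G := G) hR2 (by omega)
    omega
  obtain ⟨c, hc⟩ := hU.col R hRU
  obtain ⟨T, hT, X, hX, hTX⟩ := exists_collapse hU ih hRU.subset hR4 hc
  have hTR : Disjoint T R := disjoint_of_subset_left hT sdiff_disjoint
  have h1 := collapse_pot hTR (E := ∅) (filter_subset _ _)
    (fun p hp => (mem_filter.1 hp).2.1) (by simp) (by simp) (by simp)
    (P := (darts G (T ∪ R)).filter fun p => ¬ (p.1 ∈ R ∧ p.2 ∈ R) ∧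
          (p.1 ∈ R → c p.1 ∈ X) ∧ (p.2 ∈ R → c p.2 ∈ X))
  have h2 : pot G (T ∪ R) ≤ pot G R - 6 := by
    rcases card_fin_three_cases hX with h | h | h <;> rw [h] at hTX <;>
      simp at hTX h1 <;> linarith
  have hsub : T ∪ R ⊆ U := union_subset (hT.trans sdiff_subset) hRU.subset
  by_cases hEq : T ∪ R = U
  · rw [hEq] at h2
    linarith
  · have := hRmin (T ∪ R) ⟨hsub, hsub.ssubset_of_ne hEq,
      hR2.trans (card_le_card subset_union_right)⟩
    linarith

lemma exists_two_boundary {G : SimpleGraph V} {U R : Finset V} (hU : Crit G U)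
    (hR : R ⊂ U) (hR2 : 2 ≤ #R) :
    ∃ x ∈ R, ∃ y ∈ R, x ≠ y ∧ (∃ b ∈ U \ R, G.Adj x b) ∧ ∃ b ∈ U \ R, G.Adj y b := by
  by_contra hcon
  push Not at hcon
  obtain ⟨c₁, hc₁⟩ := hU.col R hR
  have hne : R.Nonempty := card_pos.1 (by omega)
  obtain ⟨x₀, hx₀, hx⟩ : ∃ x₀ ∈ R, ∀ y ∈ R, y ≠ x₀ → ∀ b ∈ U \ R, ¬ G.Adj y b := by
    by_cases h : ∃ x ∈ R, ∃ b ∈ U \ R, G.Adj x b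
    · obtain ⟨x, hx, hb⟩ := h
      obtain ⟨b, hb, hxb⟩ := hb
      exact ⟨x, hx, fun y hy hyx => hcon x hx y hy hyx.symm ⟨b, hb, hxb⟩⟩
    · push Not at h
      obtain ⟨x, hx⟩ := hne
      exact ⟨x, hx, fun y hy _ => h y hy⟩
  have hss : insert x₀ (U \ R) ⊂ U := by
    refine (insert_subset (hR.subset hx₀) sdiff_subset).ssubset_of_ne fun h => ?_
    obtain ⟨y, hy, hyx⟩ := exists_mem_ne (by omega : 1 < #R) x₀
    have : y ∈ insert x₀ (U \ R) := by rw [h]; exact hR.subset hy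
    simp [hyx, hy] at this
  obtain ⟨c₂, hc₂⟩ := hU.col _ hss
  let σ := Equiv.swap (c₂ x₀) (c₁ x₀)
  have hσ : σ (c₂ x₀) = c₁ x₀ := Equiv.swap_apply_left _ _
  apply hU.not_col
  refine ⟨fun v => if v ∈ R then c₁ v else σ (c₂ v), ?_⟩
  have mixed : ∀ a ∈ U, ∀ b ∈ U, a ∈ R → b ∉ R → G.Adj a b → c₁ a ≠ σ (c₂ b) := by
    intro a _ b hb haR hbR hab
    have hbU : b ∈ U \ R := by simp [hb, hbR]
    have : a = x₀ := by
      by_contra hne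
      exact hx a haR hne b hbU hab
    subst this
    rw [← hσ]
    exact fun h => hc₂ a (mem_insert_self _ _) b (mem_insert_of_mem hbU) hab (σ.injective h)
  intro a ha b hb hab
  by_cases haR : a ∈ R <;> by_cases hbR : b ∈ R <;> simp only [haR, hbR, if_true, if_false]
  · exact hc₁ a haR b hbR hab
  · exact mixed a ha b hb haR hbR hab
  · exact (mixed b hb a ha hbR haR hab.symm).symm
  · exact fun h => hc₂ a (mem_insert_of_mem (by simp [ha, haR])) b
      (mem_insert_of_mem (by simp [hb, hbR])) hab (σ.injective h)

lemma exists_coloring_ne {G : SimpleGraph V} {U R : Finset V} (hU : Crit G U)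
    (ih : KYBelow V #U) (hpot : 4 < pot G U) (hR : R ⊂ U) {x y : V} (hx : x ∈ R) (hy : y ∈ R)
    (hxy : x ≠ y) :
    ∃ c : V → Fin 3, (∀ a ∈ R, ∀ b ∈ R, G.Adj a b → c a ≠ c b) ∧ c x ≠ c y := by
  let G' := G ⊔ SimpleGraph.edge x y
  by_contra hcon
  have hnc : ¬ ColOn G' R := by
    rintro ⟨c, hc⟩
    refine hcon ⟨c, fun a ha b hb hab => hc a ha b hb (Or.inl hab), hc x hx y hy (Or.inr ?_)⟩
    simp [SimpleGraph.edge_adj, hxy]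
  obtain ⟨W, hWR, hWc, hWp⟩ := ih G' R (card_lt_card hR) hnc
  have hd : #(darts G' W) ≤ #(darts G W) + 2 := by
    have hsub : darts G' W ⊆ darts G W ∪ {(x, y), (y, x)} := by
      rintro ⟨a, b⟩ hab
      rw [mem_darts] at hab
      obtain ⟨ha, hb, hab⟩ := hab
      rcases hab with hab | hab
      · exact mem_union_left _ (mem_darts.2 ⟨ha, hb, hab⟩)
      · refine mem_union_right _ ?_
        rw [SimpleGraph.edge_adj] at hab
        simp only [mem_insert, mem_singleton, Prod.mk.injEq]
        exact hab.1
    exact (card_le_card hsub).trans ((card_union_le _ _).trans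
      (Nat.add_le_add_left card_le_two _))
  have h4 := four_le_card_of_not_colOn hWc
  have := ten_lt_pot hU ih hpot W (hWR.trans_ssubset hR) (by omega)
  unfold pot at this hWp
  omega

lemma twelve_lt_pot {G : SimpleGraph V} {U : Finset V} (hU : Crit G U)
    (ih : KYBelow V #U) (hpot : 4 < pot G U) :
    ∀ R ⊂ U, 4 ≤ #R → 12 < pot G R := by
  intro R hR hR4
  by_contra hlt
  obtain ⟨x, hx, y, hy, hxy, hbx, hby⟩ := exists_two_boundary hU hR (by omega)
  obtain ⟨c, hc, hcxy⟩ := exists_coloring_ne hU ih hpot hR hx hy hxy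
  obtain ⟨T, hT, X, hX, hTX⟩ := exists_collapse hU ih hR.subset hR4 hc
  have hTR : Disjoint T R := disjoint_of_subset_left hT sdiff_disjoint
  set P := (darts G (T ∪ R)).filter fun p => ¬ (p.1 ∈ R ∧ p.2 ∈ R) ∧
          (p.1 ∈ R → c p.1 ∈ X) ∧ (p.2 ∈ R → c p.2 ∈ X) with hP
  have hPR : ∀ p ∈ P, ¬ (p.1 ∈ R ∧ p.2 ∈ R) := fun p hp => (mem_filter.1 hp).2.1
  have h1 := collapse_pot hTR (E := ∅) (filter_subset _ _) hPR (by simp) (by simp) (by simp)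
  have hsub : T ∪ R ⊆ U := union_subset (hT.trans sdiff_subset) hR.subset
  have hbig : T ∪ R = U ∨ 10 < pot G (T ∪ R) := by
    by_cases hEq : T ∪ R = U
    · exact Or.inl hEq
    · refine Or.inr (ten_lt_pot hU ih hpot _ (hsub.ssubset_of_ne hEq) ?_)
      have := card_le_card (subset_union_right : R ⊆ T ∪ R)
      omega
  have hbig' : 4 < pot G (T ∪ R) := by
    rcases hbig with h | h
    · rwa [h]
    · linarith
  simp only [card_empty, Nat.cast_zero, mul_zero, sub_zero] at h1
  rcases card_fin_three_cases hX with h | h | h <;> rw [h] at hTX <;> norm_num at hTX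
  · obtain ⟨i, rfl⟩ := card_eq_one.1 h
    have hEq : T ∪ R = U := by
      rcases hbig with h | h
      · exact h
      · linarith
    obtain ⟨z, hz, hzi, b, hb, hzb⟩ : ∃ z ∈ R, c z ≠ i ∧ ∃ b ∈ U \ R, G.Adj z b := by
      by_cases hxi : c x = i
      · exact ⟨y, hy, fun h => hcxy (hxi.trans h.symm), hby⟩
      · exact ⟨x, hx, hxi, hbx⟩
    rw [mem_sdiff] at hb
    have h2 := collapse_pot hTR (P := P) (E := {(z, b), (b, z)}) (filter_subset _ _) hPR
      (by
        intro p hp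
        rw [hEq, mem_darts]
        simp only [mem_insert, mem_singleton] at hp
        rcases hp with rfl | rfl
        · exact ⟨hR.subset hz, hb.1, hzb⟩
        · exact ⟨hb.1, hR.subset hz, hzb.symm⟩)
      (by
        intro p hp
        simp only [mem_insert, mem_singleton] at hp
        rcases hp with rfl | rfl
        · exact fun h => hb.2 h.2
        · exact fun h => hb.2 h.1)
      (by
        rw [disjoint_right]
        intro p hp hpP
        have hpP := (mem_filter.1 hpP).2
        simp only [mem_insert, mem_singleton] at hp
        rcases hp with rfl | rfl
        · exact hzi (by simpa using hpP.2.1 hz)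
        · exact hzi (by simpa using hpP.2.2 hz))
    have hE : #({(z, b), (b, z)} : Finset (V × V)) = 2 :=
      card_pair fun h => hzb.ne (Prod.mk.inj h).1
    rw [hE] at h2
    push_cast at h2
    linarith
  · linarith
  · linarith

lemma three_le_degree {G : SimpleGraph V} {U : Finset V} (hU : Crit G U) {v : V} (hv : v ∈ U) :
    3 ≤ #(U.filter (G.Adj v)) := by
  by_contra hlt
  obtain ⟨c, hc⟩ := hU.col (U.erase v) (erase_ssubset hv)
  have hsub : (U.erase v).filter (G.Adj v) ⊆ U.filter (G.Adj v) :=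
    filter_subset_filter _ (erase_subset _ _)
  obtain ⟨k, hk⟩ := ColOn.insert_of_card hc (v := v)
    (card_image_le.trans ((card_le_card hsub).trans (by omega)))
  rw [insert_erase hv] at hk
  exact hU.not_col ⟨_, hk⟩

lemma adj_of_adjacent_degree_three {G : SimpleGraph V} {U : Finset V} (hU : Crit G U)
    (ih : KYBelow V #U) (hpot : 4 < pot G U) {x y x₁ x₂ : V} (hx : x ∈ U) (hy : y ∈ U)
    (hNx : U.filter (G.Adj x) = {y, x₁, x₂}) (hdy : #(U.filter (G.Adj y)) = 3)
    (h12 : x₁ ≠ x₂) (hy1 : y ≠ x₁) (hy2 : y ≠ x₂) : G.Adj x₁ x₂ := by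
  by_contra hnadj
  have memN : ∀ w, (w ∈ U ∧ G.Adj x w) ↔ w = y ∨ w = x₁ ∨ w = x₂ := by
    intro w
    have : w ∈ U.filter (G.Adj x) ↔ w ∈ ({y, x₁, x₂} : Finset V) := by rw [hNx]
    simpa using this
  obtain ⟨-, hxy⟩ := (memN y).2 (by simp)
  obtain ⟨hx1U, hxx1⟩ := (memN x₁).2 (by simp)
  obtain ⟨hx2U, hxx2⟩ := (memN x₂).2 (by simp)
  let f : V → V := fun v => if v = x₂ then x₁ else v
  have f2 : f x₂ = x₁ := by simp [f]
  have fN : ∀ v, v ≠ x₂ → f v = v := fun v hv => by simp [f, hv]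
  let U₀ := (U.erase x).erase y
  let U' := U₀.erase x₂
  have hU₀ : ∀ v, v ∈ U₀ ↔ v ∈ U ∧ v ≠ x ∧ v ≠ y := by
    intro v; simp only [U₀, mem_erase]; tauto
  have hU' : ∀ v, v ∈ U' ↔ v ∈ U ∧ v ≠ x ∧ v ≠ y ∧ v ≠ x₂ := by
    intro v; simp only [U', U₀, mem_erase]; tauto
  let G' : SimpleGraph V := SimpleGraph.fromRel fun u v =>
    ∃ a ∈ U₀, ∃ b ∈ U₀, G.Adj a b ∧ f a = u ∧ f b = v
  have hG' : ∀ {u v}, G'.Adj u v ↔ u ≠ v ∧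
      ∃ a ∈ U₀, ∃ b ∈ U₀, G.Adj a b ∧ f a = u ∧ f b = v := by
    intro u v
    simp only [G', SimpleGraph.fromRel_adj]
    refine and_congr_right fun _ => ⟨?_, Or.inl⟩
    rintro (h | ⟨a, ha, b, hb, hab, h1, h2⟩)
    · exact h
    · exact ⟨b, hb, a, ha, hab.symm, h2, h1⟩
  have fne : ∀ a b, G.Adj a b → f a ≠ f b := by
    intro a b hab
    by_cases ha : a = x₂ <;> by_cases hb : b = x₂
    · exact absurd (ha.trans hb.symm) hab.ne
    · subst ha; rw [f2, fN b hb]; rintro rfl; exact hnadj hab.symm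
    · subst hb; rw [f2, fN a ha]; rintro rfl; exact hnadj hab
    · rw [fN a ha, fN b hb]; exact hab.ne
  have hx1U₀ : x₁ ∈ U₀ := (hU₀ _).2 ⟨hx1U, hxx1.ne', hy1.symm⟩
  have hx2U₀ : x₂ ∈ U₀ := (hU₀ _).2 ⟨hx2U, hxx2.ne', hy2.symm⟩
  have fU' : ∀ a ∈ U₀, f a ∈ U' := by
    intro a ha
    by_cases h : a = x₂
    · subst h; rw [f2]; exact mem_erase.2 ⟨h12, hx1U₀⟩
    · rw [fN a h]; exact mem_erase.2 ⟨h, ha⟩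
  have hnc : ¬ ColOn G' U' := by
    rintro ⟨k, hk⟩
    have hc : ∀ a ∈ U₀, ∀ b ∈ U₀, G.Adj a b → (k ∘ f) a ≠ (k ∘ f) b := fun a ha b hb hab =>
      hk _ (fU' a ha) _ (fU' b hb) (hG'.2 ⟨fne a b hab, a, ha, b, hb, hab, rfl, rfl⟩)
    have hxU₀ : x ∉ U₀ := by simp [hU₀]
    have hyU₀ : y ∉ U₀ := by simp [hU₀]
    obtain ⟨i, hi⟩ := ColOn.insert_of_card hc (v := y) (by
      refine card_image_le.trans ?_
      have hsub : U₀.filter (G.Adj y) ⊆ (U.filter (G.Adj y)).erase x := by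
        intro w hw
        rw [mem_filter, hU₀] at hw
        simp [hw.1.1, hw.1.2.1, hw.2]
      refine (card_le_card hsub).trans ?_
      rw [card_erase_of_mem (by simp [hx, hxy.symm]), hdy])
    obtain ⟨j, hj⟩ := ColOn.insert_of_card hi (v := x) (by
      have hsub : ((insert y U₀).filter (G.Adj x)).image (Function.update (k ∘ f) y i) ⊆
          {i, k x₁} := by
        intro w hw
        obtain ⟨v, hv, rfl⟩ := mem_image.1 hw
        rw [mem_filter, mem_insert, hU₀] at hv
        have hvU : v ∈ U := by
          rcases hv.1 with rfl | h
          · exact hy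
          · exact h.1
        rcases (memN v).1 ⟨hvU, hv.2⟩ with rfl | rfl | rfl
        · simp
        · simp [Function.update_of_ne hy1.symm, fN v h12]
        · simp [Function.update_of_ne hy2.symm, f2]
      exact (card_le_card hsub).trans card_le_two)
    refine hU.not_col ⟨Function.update (Function.update (k ∘ f) y i) x j, ?_⟩
    have hins : insert x (insert y U₀) = U := by
      simp only [U₀]
      rw [insert_erase (mem_erase.2 ⟨hxy.ne', hy⟩), insert_erase hx]
    rwa [hins] at hj
  have hcardU' : #U' < #U :=
    card_lt_card ⟨fun v hv => ((hU' v).1 hv).1, fun h => ((hU' x).1 (h hx)).2.1 rfl⟩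
  obtain ⟨R, hRU, hRc, hRp⟩ := ih G' U' hcardU' hnc
  have hRmem : ∀ v ∈ R, v ∈ U ∧ v ≠ x ∧ v ≠ y ∧ v ≠ x₂ := fun v hv => (hU' v).1 (hRU hv)
  have hx1R : x₁ ∈ R := by
    by_contra hx1R
    have hss : R ⊂ U := ⟨fun v hv => (hRmem v hv).1, fun h => (hRmem x (h hx)).2.1 rfl⟩
    obtain ⟨k, hk⟩ := hU.col R hss
    refine hRc ⟨k, fun a ha b hb hab => hk a ha b hb ?_⟩
    obtain ⟨-, a', -, b', -, h, h1, h2⟩ := hG'.1 hab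
    have ha' : a' ≠ x₂ := by rintro rfl; rw [f2] at h1; exact hx1R (h1 ▸ ha)
    have hb' : b' ≠ x₂ := by rintro rfl; rw [f2] at h2; exact hx1R (h2 ▸ hb)
    rw [fN _ ha'] at h1
    rw [fN _ hb'] at h2
    rwa [← h1, ← h2]
  let S := insert x (insert x₂ R)
  have hx2R : x₂ ∉ R := fun h => (hRmem _ h).2.2.2 rfl
  have hxR : x ∉ insert x₂ R := by
    rw [mem_insert]
    rintro (h | h)
    · exact hxx2.ne h
    · exact (hRmem _ h).2.1 rfl
  have hS : #S = #R + 2 := by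
    simp only [S]
    rw [card_insert_of_notMem hxR, card_insert_of_notMem hx2R]
  have hSU : S ⊂ U := by
    refine ⟨?_, fun h => ?_⟩
    · refine insert_subset hx (insert_subset hx2U fun v hv => (hRmem v hv).1)
    · have := h hy
      simp only [S, mem_insert] at this
      rcases this with h | h | h
      · exact hxy.ne h.symm
      · exact hy2 h
      · exact (hRmem _ h).2.2.1 rfl
  have hd : #(darts G' R) + 4 ≤ #(darts G S) := by
    let E : Finset (V × V) := {(x, x₁), (x, x₂), (x₁, x), (x₂, x)}
    have hE : #E = 4 := by
      have e1 := hxx1.ne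
      have e2 := hxx2.ne
      simp only [E]
      rw [card_insert_of_notMem, card_insert_of_notMem, card_pair]
      · simp [h12]
      · simp [e1, e2]
      · simp [e1, e2, h12]
    have hsub : darts G' R ⊆ (darts G S \ E).image (Prod.map f f) := by
      rintro ⟨u, v⟩ huv
      rw [mem_darts] at huv
      obtain ⟨hu, hv, huv⟩ := huv
      obtain ⟨-, a, ha, b, hb, hab, rfl, rfl⟩ := hG'.1 huv
      have aux : ∀ w, f w ∈ R → w ∈ S := by
        intro w hw
        by_cases h : w = x₂
        · simp [S, h]
        · rw [fN w h] at hw; simp [S, hw]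
      refine mem_image.2 ⟨(a, b), ?_, rfl⟩
      rw [mem_sdiff, mem_darts]
      refine ⟨⟨aux a hu, aux b hv, hab⟩, ?_⟩
      have hax := ((hU₀ a).1 ha).2.1
      have hbx := ((hU₀ b).1 hb).2.1
      simp [E, hax, hbx]
    have h1 := (card_le_card hsub).trans card_image_le
    have hES : E ⊆ darts G S := by
      intro p hp
      simp only [E, mem_insert, mem_singleton] at hp
      rcases hp with rfl | rfl | rfl | rfl <;>
        simp [mem_darts, S, hx1R, hxx1, hxx2, hxx1.symm, hxx2.symm]
    have h2 := card_sdiff_add_card_eq_card hES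
    omega
  have h4 := four_le_card_of_not_colOn hRc
  have := twelve_lt_pot hU ih hpot S hSU (by omega)
  unfold pot at this hRp
  rw [hS] at this
  push_cast at this
  omega

lemma card_degree_three_neighbors_le {G : SimpleGraph V} {U : Finset V} (hU : Crit G U)
    (ih : KYBelow V #U) (hpot : 4 < pot G U) {v : V} (hv : v ∈ U)
    (hdv : #(U.filter (G.Adj v)) = 3) :
    #((U.filter fun w => #(U.filter (G.Adj w)) = 3).filter (G.Adj v)) ≤ 1 := by
  by_contra hlt
  obtain ⟨a, ha, b, hb, hab⟩ := one_lt_card.1 (not_le.1 hlt)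
  simp only [mem_filter] at ha hb
  obtain ⟨⟨haU, hda⟩, hva⟩ := ha
  obtain ⟨⟨hbU, hdb⟩, hvb⟩ := hb
  obtain ⟨c, hc⟩ : ∃ c, ((U.filter (G.Adj v)).erase a).erase b = {c} := by
    rw [← card_eq_one, card_erase_of_mem, card_erase_of_mem, hdv]
    · simp [haU, hva]
    · simp [hbU, hvb, hab.symm]
  have hcm : c ∈ ((U.filter (G.Adj v)).erase a).erase b := by simp [hc]
  simp only [mem_erase, mem_filter] at hcm
  obtain ⟨hcb, hca, hcU, hvc⟩ := hcm
  have hN : U.filter (G.Adj v) = {a, b, c} := by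
    rw [← hc, insert_erase (by simp [hbU, hvb, hab.symm]), insert_erase (by simp [haU, hva])]
  have hbc : G.Adj b c :=
    adj_of_adjacent_degree_three hU ih hpot hv haU hN hda hcb.symm hab hca.symm
  have hac : G.Adj a c :=
    adj_of_adjacent_degree_three hU ih hpot hv hbU (by rw [hN, insert_comm]) hdb
      hca.symm hab.symm hcb.symm
  let S : Finset V := {v, a, b, c}
  have hva' := hva.ne
  have hvb' := hvb.ne
  have hvc' := hvc.ne
  have hS : #S = 4 := by
    simp only [S]
    rw [card_insert_of_notMem, card_insert_of_notMem, card_pair hcb.symm]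
    · simp [hab, hca.symm]
    · simp [hva', hvb', hvc']
  have hSU : S ⊆ U := by
    intro w hw
    simp only [S, mem_insert, mem_singleton] at hw
    rcases hw with rfl | rfl | rfl | rfl <;> assumption
  have deg : ∀ w ∈ S, ∀ s ⊆ S.filter (G.Adj w), #s ≤ #(S.filter (G.Adj w)) :=
    fun _ _ s hs => card_le_card hs
  by_cases hEq : S = U
  · have hd : #(darts G U) = ∑ w ∈ U, #(U.filter (G.Adj w)) := darts_card_eq_sum G U
    have h3 : #U * 3 ≤ #(darts G U) := by
      rw [hd, ← smul_eq_mul, ← sum_const]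
      exact sum_le_sum fun w hw => three_le_degree hU hw
    unfold pot at hpot
    rw [← hEq, hS] at h3 hpot
    push_cast at hpot
    omega
  · have h10 := ten_lt_pot hU ih hpot S (hSU.ssubset_of_ne hEq) (by omega)
    let E : Finset (V × V) := ({v} : Finset V) ×ˢ {a, b, c} ∪ ({a, b, c} : Finset V) ×ˢ {v} ∪
      ({c} : Finset V) ×ˢ {a, b} ∪ ({a, b} : Finset V) ×ˢ {c}
    have h3 : #({a, b, c} : Finset V) = 3 := by rw [← hN, hdv]
    have hE : #E = 10 := by
      simp only [E]
      rw [card_union_of_disjoint, card_union_of_disjoint, card_union_of_disjoint]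
      · simp only [card_product, h3, card_singleton, card_pair hab]
      all_goals
        rw [disjoint_left]
        rintro ⟨p, q⟩
        simp only [mem_union, mem_product, mem_singleton, mem_insert]
        grind
    have hES : E ⊆ darts G S := by
      rintro ⟨p, q⟩ hp
      simp only [E, mem_union, mem_product, mem_singleton, mem_insert] at hp
      simp only [mem_darts, S, mem_insert, mem_singleton]
      have := hva.symm
      have := hvb.symm
      have := hvc.symm
      have := hbc.symm
      have := hac.symm
      grind
    have hd := card_le_card hES
    unfold pot at h10
    rw [hS] at h10
    push_cast at h10
    omega

/-- The Kostochka–Yancey bound for 4-critical graphs. -/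
lemma kostochka_yancey (G : SimpleGraph V) (U : Finset V) (h : ¬ ColOn G U) :
    ∃ R ⊆ U, ¬ ColOn G R ∧ pot G R ≤ 4 := by
  suffices ∀ n, KYBelow V n from this (#U + 1) G U (Nat.lt_succ_self _) h
  intro n
  induction n with
  | zero => intro G U hU; omega
  | succ n ihn =>
    intro G U hUn hnc
    by_cases hcr : ∃ R ⊂ U, ¬ ColOn G R
    · obtain ⟨R, hR, hRc⟩ := hcr
      have := card_lt_card hR
      obtain ⟨S, hS, hSc⟩ := ihn G R (by omega) hRc
      exact ⟨S, hS.trans hR.subset, hSc⟩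
    · push Not at hcr
      have hU : Crit G U := ⟨hnc, hcr⟩
      have ih : KYBelow V #U := fun G' U' h' => ihn G' U' (by omega)
      refine ⟨U, subset_rfl, hnc, ?_⟩
      by_contra hpot
      rw [not_le] at hpot
      set A := U.filter fun w => #(U.filter (G.Adj w)) = 3 with hA
      set B := U.filter fun w => ¬ #(U.filter (G.Adj w)) = 3 with hB
      have hAB : #A + #B = #U := card_filter_add_card_filter_not _
      have hd : #(darts G U) = 3 * #A + ∑ w ∈ B, #(U.filter (G.Adj w)) := by
        rw [darts_card_eq_sum, ← sum_filter_add_sum_filter_not U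
          (fun w => #(U.filter (G.Adj w)) = 3), mul_comm, ← smul_eq_mul, ← sum_const]
        congr 1
        exact sum_congr rfl fun w hw => (mem_filter.1 hw).2
      have h4 : #B * 4 ≤ ∑ w ∈ B, #(U.filter (G.Adj w)) := by
        rw [← smul_eq_mul, ← sum_const]
        refine sum_le_sum fun w hw => ?_
        rw [hB, mem_filter] at hw
        have := three_le_degree hU hw.1
        omega
      have h2 : #A * 2 ≤ ∑ w ∈ B, #(U.filter (G.Adj w)) := by
        calc #A * 2 ≤ ∑ v ∈ A, #(B.filter (G.Adj v)) := by
              rw [← smul_eq_mul, ← sum_const]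
              refine sum_le_sum fun v hv => ?_
              rw [hA, mem_filter] at hv
              have h1 : #(A.filter (G.Adj v)) ≤ 1 :=
                card_degree_three_neighbors_le hU ih hpot hv.1 hv.2
              have h3 : #(A.filter (G.Adj v)) + #(B.filter (G.Adj v)) =
                  #(U.filter (G.Adj v)) := by
                rw [hA, hB, filter_comm, filter_comm (s := U)
                  (p := fun w => ¬ #(U.filter (G.Adj w)) = 3)]
                exact card_filter_add_card_filter_not _
              omega
          _ = ∑ w ∈ B, #(A.filter fun v => G.Adj v w) := by
              simp only [card_filter]
              exact sum_comm
          _ ≤ _ := by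
              refine sum_le_sum fun w _ => card_le_card fun v hv => ?_
              rw [mem_filter] at hv
              exact mem_filter.2 ⟨(mem_filter.1 hv.1).1, hv.2.symm⟩
      unfold pot at hpot
      omega

end KostochkaYancey

section AlgebraicDual

open Finset Classical

/-- Symmetric `ZMod 2`-valued functions on the darts of `G`. -/
structure EdgeChain (G : SimpleGraph V) (z : V → V → ZMod 2) : Prop where
  symm : ∀ a b, z a b = z b a
  zero : ∀ a b, ¬ G.Adj a b → z a b = 0

/-- `φ a b` is the face to the left of the dart from `a` to `b`: the mod 2 cycles of `G` are
exactly the cuts of the dual graph on the faces. -/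
def IsDual [Fintype V] {F : Type} (G : SimpleGraph V) (φ : V → V → F) : Prop :=
  ∀ z : V → V → ZMod 2, EdgeChain G z →
    ((∀ a, ∑ b, z a b = 0) ↔
      ∃ S : F → ZMod 2, ∀ a b, G.Adj a b → z a b = S (φ a b) + S (φ b a))

/-- `G` has an algebraic dual. -/
def HasDual [Fintype V] (G : SimpleGraph V) : Prop :=
  ∃ (F : Type) (φ : V → V → F), IsDual G φ

/-- The edges of `G` inside `s`, on the same vertex type. -/
def within (G : SimpleGraph V) (s : Set V) : SimpleGraph V where
  Adj a b := G.Adj a b ∧ a ∈ s ∧ b ∈ s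
  symm := ⟨fun _ _ h => ⟨h.1.symm, h.2.2, h.2.1⟩⟩
  loopless := ⟨fun _ h => h.1.ne rfl⟩

/-- The indicator of a single edge. -/
noncomputable def edgeInd (x y : V) (a b : V) : ZMod 2 := if s(a, b) = s(x, y) then 1 else 0

lemma EdgeChain.add {G : SimpleGraph V} {z w : V → V → ZMod 2} (hz : EdgeChain G z)
    (hw : EdgeChain G w) : EdgeChain G fun a b => z a b + w a b :=
  ⟨fun a b => by rw [hz.symm, hw.symm], fun a b h => by rw [hz.zero a b h, hw.zero a b h, add_zero]⟩

lemma EdgeChain.mono {G G' : SimpleGraph V} {z : V → V → ZMod 2} (hz : EdgeChain G z)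
    (h : G ≤ G') : EdgeChain G' z :=
  ⟨hz.symm, fun a b hab => hz.zero a b fun h' => hab (h h')⟩

lemma edgeChain_edgeInd {G : SimpleGraph V} {x y : V} (h : G.Adj x y) :
    EdgeChain G (edgeInd x y) := by
  refine ⟨fun a b => by rw [edgeInd, edgeInd, Sym2.eq_swap], fun a b hab => if_neg fun he => hab ?_⟩
  rwa [← SimpleGraph.mem_edgeSet, he]

lemma sum_edgeInd [Fintype V] {x y : V} (h : x ≠ y) (a : V) :
    ∑ b, edgeInd x y a b = (if a = x then 1 else 0) + if a = y then 1 else 0 := by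
  have : ∀ b, edgeInd x y a b =
      (if b = y then if a = x then 1 else 0 else 0) +
        if b = x then if a = y then 1 else 0 else 0 := by
    intro b
    simp only [edgeInd, Sym2.eq_iff]
    by_cases h1 : a = x <;> by_cases h2 : a = y <;> by_cases h3 : b = x <;>
      by_cases h4 : b = y <;> simp_all
  simp [this, sum_add_distrib]

lemma exists_chain_of_reachable [Fintype V] {K : SimpleGraph V} {a b : V}
    (h : K.Reachable a b) :
    ∃ z, EdgeChain K z ∧
      ∀ x, ∑ y, z x y = (if x = a then 1 else 0) + if x = b then 1 else 0 := by
  obtain ⟨p⟩ := h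
  induction p with
  | nil => exact ⟨fun _ _ => 0, ⟨by simp, by simp⟩, fun x => by simp [CharTwo.add_self_eq_zero]⟩
  | @cons u v w huv p ih =>
    obtain ⟨z, hz, hz'⟩ := ih
    refine ⟨_, (edgeChain_edgeInd huv).add hz, fun x => ?_⟩
    rw [sum_add_distrib, sum_edgeInd huv.ne, hz']
    linear_combination CharTwo.add_self_eq_zero (if x = v then (1 : ZMod 2) else 0)

lemma sum_sum_eq_zero_of_symm {s : Finset V} {z : V → V → ZMod 2} (h : ∀ a b, z a b = z b a)
    (h0 : ∀ a, z a a = 0) : ∑ a ∈ s, ∑ b ∈ s, z a b = 0 := by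
  rw [← sum_product']
  refine sum_involution (fun p _ => p.swap) ?_ ?_ ?_ ?_
  · rintro ⟨a, b⟩ -
    simp only [Prod.swap]
    rw [h b a, CharTwo.add_self_eq_zero]
  · rintro ⟨a, b⟩ - hz heq
    simp only [Prod.swap, Prod.mk.injEq] at heq
    rw [heq.1] at hz
    exact hz (h0 _)
  · rintro ⟨a, b⟩ hab
    simp only [mem_product] at hab
    simpa using hab.symm
  · rintro ⟨a, b⟩ -
    rfl

lemma IsDual.deletion [Fintype V] {F : Type} {G G' : SimpleGraph V} {φ : V → V → F}
    (hφ : IsDual G φ) (hle : G' ≤ G) : HasDual G' := by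
  let r : F → F → Prop := fun f g => ∃ a b, G.Adj a b ∧ ¬ G'.Adj a b ∧ f = φ a b ∧ g = φ b a
  refine ⟨Quot r, fun a b => Quot.mk r (φ a b), fun z hz => ?_⟩
  rw [hφ z (hz.mono hle)]
  constructor
  · rintro ⟨S, hS⟩
    refine ⟨Quot.lift S ?_, fun a b hab => hS a b (hle hab)⟩
    rintro _ _ ⟨a, b, hab, hab', rfl, rfl⟩
    have := hS a b hab
    rw [hz.zero a b hab'] at this
    exact CharTwo.add_eq_zero.1 this.symm
  · rintro ⟨S, hS⟩
    refine ⟨fun f => S (Quot.mk r f), fun a b hab => ?_⟩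
    by_cases h : G'.Adj a b
    · exact hS a b h
    · have hq : Quot.mk r (φ a b) = Quot.mk r (φ b a) := Quot.sound ⟨a, b, hab, h, rfl, rfl⟩
      simp only [hz.zero a b h, hq, CharTwo.add_self_eq_zero]

lemma HasDual.mono [Fintype V] {G G' : SimpleGraph V} (h : HasDual G) (hle : G' ≤ G) :
    HasDual G' := by
  obtain ⟨F, φ, hφ⟩ := h
  exact hφ.deletion hle

/-- `v₀ v₁ v₂ v₃` is a 4-cycle of `G` whose edges are exactly those with precisely one side `f`. -/
structure FourFace {F : Type} (G : SimpleGraph V) (φ : V → V → F) (f : F) (v₀ v₁ v₂ v₃ : V) :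
    Prop where
  adj₀₁ : G.Adj v₀ v₁
  adj₁₂ : G.Adj v₁ v₂
  adj₂₃ : G.Adj v₂ v₃
  adj₃₀ : G.Adj v₃ v₀
  ne₀₂ : v₀ ≠ v₂
  ne₁₃ : v₁ ≠ v₃
  side : ∀ p q, G.Adj p q → (¬ (φ p q = f ↔ φ q p = f) ↔
    s(p, q) = s(v₀, v₁) ∨ s(p, q) = s(v₁, v₂) ∨ s(p, q) = s(v₂, v₃) ∨ s(p, q) = s(v₃, v₀))

lemma FourFace.rotate {F : Type} {G : SimpleGraph V} {φ : V → V → F} {f : F} {v₀ v₁ v₂ v₃ : V}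
    (h : FourFace G φ f v₀ v₁ v₂ v₃) : FourFace G φ f v₁ v₂ v₃ v₀ :=
  ⟨h.adj₁₂, h.adj₂₃, h.adj₃₀, h.adj₀₁, h.ne₁₃, h.ne₀₂.symm, fun p q hpq => by
    rw [h.side p q hpq]; tauto⟩

lemma IsDual.chord [Fintype V] {F : Type} {G : SimpleGraph V} {φ : V → V → F} {f : F}
    {v₀ v₁ v₂ v₃ : V} (hφ : IsDual G φ) (h : FourFace G φ f v₀ v₁ v₂ v₃)
    (h02 : ¬ G.Adj v₀ v₂) : HasDual (G ⊔ SimpleGraph.edge v₀ v₂) := by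
  have hadj : ∀ a b, (G ⊔ SimpleGraph.edge v₀ v₂).Adj a b ↔ G.Adj a b ∨ s(a, b) = s(v₀, v₂) := by
    intro a b
    rw [SimpleGraph.sup_adj, SimpleGraph.edge_adj, Sym2.eq_iff]
    have := h.ne₀₂
    constructor
    · tauto
    · rintro (h | ⟨rfl, rfl⟩ | ⟨rfl, rfl⟩) <;> simp [*, this.symm]
  let C : V → V → ZMod 2 := fun a b => edgeInd v₂ v₃ a b + edgeInd v₃ v₀ a b + edgeInd v₀ v₂ a b
  have hCsum : ∀ a, ∑ b, C a b = 0 := by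
    intro a
    simp only [C, sum_add_distrib, sum_edgeInd h.adj₂₃.ne, sum_edgeInd h.adj₃₀.ne,
      sum_edgeInd h.ne₀₂]
    linear_combination CharTwo.add_self_eq_zero (if a = v₀ then (1 : ZMod 2) else 0) +
      CharTwo.add_self_eq_zero (if a = v₂ then (1 : ZMod 2) else 0) +
      CharTwo.add_self_eq_zero (if a = v₃ then (1 : ZMod 2) else 0)
  have hCsymm : ∀ a b, C a b = C b a := fun a b => by
    simp only [C, edgeInd, Sym2.eq_swap (a := a)]
  let T : Sym2 V → Prop := fun e => e = s(v₂, v₃) ∨ e = s(v₃, v₀)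
  have hT02 : ¬ T s(v₀, v₂) := by
    have h1 := h.adj₂₃.ne
    have h2 := h.adj₃₀.ne
    simp [T, h1, h2.symm, h.ne₀₂, h.ne₀₂.symm]
  have hCT : ∀ a b, G.Adj a b → C a b = if T s(a, b) then 1 else 0 := by
    intro a b hab
    have h1 : s(a, b) ≠ s(v₀, v₂) := fun he => h02 (by rwa [← SimpleGraph.mem_edgeSet, ← he])
    have h2 : s(v₂, v₃) ≠ s(v₃, v₀) := by simp [h.ne₀₂.symm, h.adj₂₃.ne]
    by_cases h3 : s(a, b) = s(v₂, v₃)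
    · simp only [C, edgeInd, T, h3, h3 ▸ h1, h2, if_true, if_false, true_or, add_zero]
    · by_cases h4 : s(a, b) = s(v₃, v₀)
      · simp only [C, edgeInd, T, h4, h4 ▸ h1, h2.symm, if_true, if_false, or_true, add_zero,
          zero_add]
      · simp only [C, edgeInd, T, h1, h3, h4, if_false, or_self, add_zero]
  have hC02 : C v₀ v₂ = 1 := by
    have := hT02
    simp only [T, not_or] at this
    simp only [C, edgeInd, this.1, this.2, if_true, if_false, zero_add]
  let ψ : V → V → Option F := fun a b =>
    if s(a, b) = s(v₀, v₂) then (if a = v₀ then some f else none)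
    else if φ a b = f ∧ T s(a, b) then none else some (φ a b)
  refine ⟨Option F, ψ, fun z hz => ?_⟩
  set t := z v₀ v₂ with ht
  let w : V → V → ZMod 2 := fun a b => z a b + t * C a b
  have hwsum : ∀ a, ∑ b, w a b = ∑ b, z a b := fun a => by
    simp only [w, sum_add_distrib, ← mul_sum, hCsum, mul_zero, add_zero]
  have hz02 : ∀ a b, s(a, b) = s(v₀, v₂) → z a b = t ∧ C a b = 1 := by
    intro a b hab
    rcases Sym2.eq_iff.1 hab with ⟨rfl, rfl⟩ | ⟨rfl, rfl⟩
    · exact ⟨rfl, hC02⟩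
    · exact ⟨hz.symm _ _, by rw [hCsymm, hC02]⟩
  have hw : EdgeChain G w := by
    refine ⟨fun a b => by simp only [w, hz.symm a b, hCsymm a b], fun a b hab => ?_⟩
    by_cases he : s(a, b) = s(v₀, v₂)
    · simp [w, hz02 a b he, CharTwo.add_self_eq_zero]
    · have h1 : z a b = 0 := hz.zero a b fun h' => ((hadj a b).1 h').elim hab he
      have h2 : ∀ x y, G.Adj x y → s(a, b) ≠ s(x, y) := fun x y hxy he =>
        hab (by rwa [← SimpleGraph.mem_edgeSet, he])
      simp only [w, h1, C, edgeInd, he, h2 _ _ h.adj₂₃, h2 _ _ h.adj₃₀, if_false, add_zero,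
        mul_zero]
  have hside : ∀ a b, G.Adj a b → T s(a, b) → ¬ (φ a b = f ↔ φ b a = f) := by
    intro a b hab hT
    rw [h.side a b hab]
    simp only [T] at hT
    tauto
  have key : ∀ (S' : Option F → ZMod 2), S' (some f) + S' none = t →
      ∀ a b, G.Adj a b →
        (w a b = S' (some (φ a b)) + S' (some (φ b a)) ↔ z a b = S' (ψ a b) + S' (ψ b a)) := by
    intro S' hS' a b hab
    have h1 : s(a, b) ≠ s(v₀, v₂) := fun he => h02 (by rwa [← SimpleGraph.mem_edgeSet, ← he])
    have h1' : s(b, a) ≠ s(v₀, v₂) := by rwa [Sym2.eq_swap]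
    simp only [w, ψ, if_neg h1, if_neg h1', hCT a b hab, Sym2.eq_swap (a := b)]
    by_cases hT : T s(a, b)
    · have hs := hside a b hab hT
      by_cases ha : φ a b = f
      · have hb : φ b a ≠ f := fun hb => hs (by simp [ha, hb])
        simp only [ha, hb, hT, and_self, if_true, false_and, if_false, mul_one]
        rw [← hS']
        have e := CharTwo.add_self_eq_zero (S' (some f))
        have e' := CharTwo.add_self_eq_zero (S' none)
        constructor <;> intro h
        · linear_combination h - e'
        · linear_combination h + e'
      · have hb : φ b a = f := by
          by_contra hb
          exact hs (by simp [ha, hb])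
        simp only [ha, hb, hT, and_self, if_true, false_and, if_false, mul_one]
        rw [← hS']
        have e := CharTwo.add_self_eq_zero (S' (some f))
        have e' := CharTwo.add_self_eq_zero (S' none)
        constructor <;> intro h
        · linear_combination h - e'
        · linear_combination h + e'
    · simp [hT]
  have hψ02 : ψ v₀ v₂ = some f := by simp [ψ]
  have hψ20 : ψ v₂ v₀ = none := by simp [ψ, h.ne₀₂.symm]
  have hstep := hφ w hw
  simp only [hwsum] at hstep
  rw [hstep]
  constructor
  · rintro ⟨S, hS⟩
    refine ⟨fun o => o.elim (S f + t) S, fun a b hab => ?_⟩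
    rcases (hadj a b).1 hab with hab | hab
    · refine (key (fun o => o.elim (S f + t) S) ?_ a b hab).1 (hS a b hab)
      simp only [Option.elim]
      linear_combination CharTwo.add_self_eq_zero (S f)
    · rw [(hz02 a b hab).1]
      rcases Sym2.eq_iff.1 hab with ⟨rfl, rfl⟩ | ⟨rfl, rfl⟩ <;> rw [hψ02, hψ20] <;>
        simp only [Option.elim] <;> linear_combination - CharTwo.add_self_eq_zero (S f)
  · rintro ⟨S', hS'⟩
    have h1 := hS' v₀ v₂ ((hadj _ _).2 (Or.inr rfl))
    rw [hψ02, hψ20] at h1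
    exact ⟨fun g => S' (some g), fun a b hab =>
      (key S' h1.symm a b hab).2 (hS' a b ((hadj a b).2 (Or.inl hab)))⟩

end AlgebraicDual

section Minor

open Finset Classical

lemma EdgeChain.sum {G : SimpleGraph V} {ι : Type*} (s : Finset ι) {z : ι → V → V → ZMod 2}
    (hz : ∀ i ∈ s, EdgeChain G (z i)) : EdgeChain G fun a b => ∑ i ∈ s, z i a b :=
  ⟨fun a b => sum_congr rfl fun i hi => (hz i hi).symm a b,
    fun a b h => sum_eq_zero fun i hi => (hz i hi).zero a b h⟩

lemma EdgeChain.smul {G : SimpleGraph V} {z : V → V → ZMod 2} (hz : EdgeChain G z) (t : ZMod 2) :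
    EdgeChain G fun a b => t * z a b :=
  ⟨fun a b => by rw [hz.symm], fun a b h => by rw [hz.zero a b h, mul_zero]⟩

lemma exists_representatives {W : Type*} [Nonempty W] {G : SimpleGraph W} {G' : SimpleGraph V}
    {B : V → Set W}
    (hB : ∀ u v, G'.Adj u v → ∃ a ∈ B u, ∃ b ∈ B v, G.Adj a b) :
    ∃ A : V → V → W, ∀ u v, G'.Adj u v → A u v ∈ B u ∧ G.Adj (A u v) (A v u) := by
  choose! f hf g hg hfg using hB
  let r : V → V → Prop := WellOrderingRel
  refine ⟨fun u v => if r u v then f u v else g v u, fun u v huv => ?_⟩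
  rcases trichotomous_of r u v with h | h | h
  · have h' : ¬ r v u := asymm_of r h
    simp only [h, h', if_true, if_false]
    exact ⟨hf u v huv, hfg u v huv⟩
  · exact absurd h huv.ne
  · have h' : ¬ r u v := asymm_of r h
    simp only [h, h', if_true, if_false]
    exact ⟨hg v u huv.symm, (hfg v u huv.symm).symm⟩

/-- A minor of a graph with an algebraic dual has an algebraic dual. -/
lemma HasDual.minor [Fintype V] {W : Type*} [Fintype W] [Nonempty W] {G : SimpleGraph W}
    {G' : SimpleGraph V}
    (hG : HasDual G) (B : V → Set W) (hdisj : ∀ u v a, a ∈ B u → a ∈ B v → u = v)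
    (hconn : ∀ v, ∀ a ∈ B v, ∀ b ∈ B v, (within G (B v)).Reachable a b)
    (hB : ∀ u v, G'.Adj u v → ∃ a ∈ B u, ∃ b ∈ B v, G.Adj a b) : HasDual G' := by
  obtain ⟨A, hA⟩ := exists_representatives hB
  let K : SimpleGraph W :=
    { Adj := fun a b => G.Adj a b ∧ ((∃ v, a ∈ B v ∧ b ∈ B v) ∨
        ∃ u v, G'.Adj u v ∧ a = A u v ∧ b = A v u)
      symm := ⟨by
        rintro a b ⟨h, ⟨v, hv⟩ | ⟨u, v, huv, ha, hb⟩⟩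
        · exact ⟨h.symm, Or.inl ⟨v, hv.symm⟩⟩
        · exact ⟨h.symm, Or.inr ⟨v, u, huv.symm, hb, ha⟩⟩⟩
      loopless := ⟨fun a h => h.1.ne rfl⟩ }
  have hKG : K ≤ G := fun a b h => h.1
  have hwK : ∀ v, within G (B v) ≤ K := fun v a b h => ⟨h.1, Or.inl ⟨v, h.2⟩⟩
  have hAK : ∀ u v, G'.Adj u v → K.Adj (A u v) (A v u) :=
    fun u v h => ⟨(hA u v h).2, Or.inr ⟨u, v, h, rfl, rfl⟩⟩
  obtain ⟨F, φ, hφ⟩ := hG.mono hKG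
  refine ⟨F, fun u v => φ (A u v) (A v u), fun z hz => ?_⟩
  have hz' : ∀ u v, z u v ≠ 0 → G'.Adj u v := fun u v h => by
    by_contra h'
    exact h (hz.zero u v h')
  let z₀ : W → W → ZMod 2 := fun a b =>
    ∑ u, ∑ v, z u v * ((if a = A u v then 1 else 0) * if b = A v u then 1 else 0)
  have hz₀chain : EdgeChain K z₀ := by
    constructor
    · intro a b
      simp only [z₀]
      rw [sum_comm]
      refine sum_congr rfl fun u _ => sum_congr rfl fun v _ => ?_
      rw [hz.symm]
      ring
    · intro a b hab
      refine sum_eq_zero fun u _ => sum_eq_zero fun v _ => ?_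
      by_contra h
      have h1 := hz' u v (left_ne_zero_of_mul h)
      have h2 := left_ne_zero_of_mul (right_ne_zero_of_mul h)
      have h3 := right_ne_zero_of_mul (right_ne_zero_of_mul h)
      simp only [ne_eq, ite_eq_right_iff, one_ne_zero, imp_false, not_not] at h2 h3
      rw [h2, h3] at hab
      exact hab (hAK u v h1)
  have hz₀rep : ∀ u v, G'.Adj u v → z₀ (A u v) (A v u) = z u v := by
    intro u v huv
    simp only [z₀]
    rw [sum_eq_single u, sum_eq_single v]
    · simp
    · intro v' _ hv'
      by_contra h
      have h1 := hz' u v' (left_ne_zero_of_mul h)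
      have h3 := right_ne_zero_of_mul (right_ne_zero_of_mul h)
      simp only [ne_eq, ite_eq_right_iff, one_ne_zero, imp_false, not_not] at h3
      exact hv' (hdisj _ _ _ (h3 ▸ (hA v' u h1.symm).1) (hA v u huv.symm).1)
    · simp
    · intro u' _ hu'
      refine sum_eq_zero fun v' _ => ?_
      by_contra h
      have h1 := hz' u' v' (left_ne_zero_of_mul h)
      have h2 := left_ne_zero_of_mul (right_ne_zero_of_mul h)
      simp only [ne_eq, ite_eq_right_iff, one_ne_zero, imp_false, not_not] at h2
      exact hu' (hdisj _ _ _ (h2 ▸ (hA u' v' h1).1) (hA u v huv).1)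
    · simp
  have hz₀sum : ∀ a, ∑ b, z₀ a b = ∑ u, ∑ v, z u v * if a = A u v then 1 else 0 := by
    intro a
    simp only [z₀]
    rw [sum_comm]
    refine sum_congr rfl fun u _ => ?_
    rw [sum_comm]
    refine sum_congr rfl fun v _ => ?_
    rw [← mul_sum, ← mul_sum]
    simp
  have hz₀in : ∀ w a b, a ∈ B w → b ∈ B w → z₀ a b = 0 := by
    intro w a b ha hb
    refine sum_eq_zero fun u _ => sum_eq_zero fun v _ => ?_
    by_contra h
    have h1 := hz' u v (left_ne_zero_of_mul h)
    have h2 := left_ne_zero_of_mul (right_ne_zero_of_mul h)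
    have h3 := right_ne_zero_of_mul (right_ne_zero_of_mul h)
    simp only [ne_eq, ite_eq_right_iff, one_ne_zero, imp_false, not_not] at h2 h3
    subst h2 h3
    exact h1.ne ((hdisj _ _ _ (hA u v h1).1 ha).trans (hdisj _ _ _ (hA v u h1.symm).1 hb).symm)
  constructor
  · intro hcyc
    obtain ⟨r, hr⟩ : ∃ r : V → W, ∀ u, ∀ a ∈ B u, r u ∈ B u := by
      have : ∀ u, ∃ r : W, ∀ a ∈ B u, r ∈ B u := by
        intro u
        by_cases h : (B u).Nonempty
        · exact ⟨h.some, fun _ _ => h.some_mem⟩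
        · exact ⟨Classical.arbitrary W, fun a ha => (h ⟨a, ha⟩).elim⟩
      choose r hr using this
      exact ⟨r, hr⟩
    have hP : ∀ u v, ∃ P : W → W → ZMod 2, G'.Adj u v → EdgeChain (within G (B u)) P ∧
        ∀ x, ∑ y, P x y = (if x = A u v then 1 else 0) + if x = r u then 1 else 0 := by
      intro u v
      by_cases huv : G'.Adj u v
      · have ha := (hA u v huv).1
        obtain ⟨P, hP⟩ := exists_chain_of_reachable (hconn u _ ha _ (hr u _ ha))
        exact ⟨P, fun _ => hP⟩
      · exact ⟨fun _ _ => 0, fun h => absurd h huv⟩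
    choose P hP using hP
    let z₁ : W → W → ZMod 2 := fun a b => ∑ u, ∑ v, z u v * P u v a b
    have hz₁ : EdgeChain K z₁ := by
      refine EdgeChain.sum _ fun u _ => EdgeChain.sum _ fun v _ => ?_
      by_cases huv : G'.Adj u v
      · exact ((hP u v huv).1.mono (hwK u)).smul _
      · simp only [hz.zero u v huv, zero_mul]
        exact ⟨fun _ _ => rfl, fun _ _ _ => rfl⟩
    have hcyc' : ∀ a, ∑ b, (z₀ a b + z₁ a b) = 0 := by
      intro a
      have h1 : ∑ b, z₁ a b = ∑ u, ∑ v, z u v *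
          ((if a = A u v then 1 else 0) + if a = r u then 1 else 0) := by
        simp only [z₁]
        rw [sum_comm]
        refine sum_congr rfl fun u _ => ?_
        rw [sum_comm]
        refine sum_congr rfl fun v _ => ?_
        rw [← mul_sum]
        by_cases huv : G'.Adj u v
        · rw [(hP u v huv).2]
        · simp only [hz.zero u v huv, zero_mul]
      have h2 : ∑ u, ∑ v, z u v * (if a = r u then 1 else 0) = 0 :=
        sum_eq_zero fun u _ => by rw [← sum_mul, hcyc, zero_mul]
      rw [sum_add_distrib, hz₀sum, h1]
      simp only [mul_add, sum_add_distrib, h2, add_zero, CharTwo.add_self_eq_zero]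
    obtain ⟨S, hS⟩ := (hφ _ (hz₀chain.add hz₁)).1 hcyc'
    refine ⟨S, fun u v huv => ?_⟩
    rw [← hS _ _ (hAK u v huv), hz₀rep u v huv]
    suffices z₁ (A u v) (A v u) = 0 by rw [this, add_zero]
    refine sum_eq_zero fun u' _ => sum_eq_zero fun v' _ => ?_
    by_cases h' : G'.Adj u' v'
    · rw [(hP u' v' h').1.zero, mul_zero]
      rintro ⟨-, h1, h2⟩
      exact huv.ne ((hdisj _ _ _ (hA u v huv).1 h1).trans
        (hdisj _ _ _ (hA v u huv.symm).1 h2).symm)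
    · rw [hz.zero u' v' h', zero_mul]
  · rintro ⟨S, hS⟩ w
    let y : W → W → ZMod 2 := fun a b => if K.Adj a b then S (φ a b) + S (φ b a) else 0
    have hy : EdgeChain K y :=
      ⟨fun a b => by simp only [y, K.adj_comm a b, add_comm], fun a b h => if_neg h⟩
    have hycyc := (hφ y hy).2 ⟨S, fun a b h => if_pos h⟩
    let s : Finset W := univ.filter (· ∈ B w)
    have hsum : ∑ a ∈ s, ∑ b, z₀ a b = ∑ v, z w v := by
      simp only [hz₀sum]
      rw [sum_comm, sum_eq_single w, sum_comm]
      · refine sum_congr rfl fun v _ => ?_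
        rw [← mul_sum]
        by_cases hv : G'.Adj w v
        · simp [s, (hA w v hv).1]
        · rw [hz.zero w v hv, zero_mul]
      · intro u _ hu
        refine sum_eq_zero fun a ha => sum_eq_zero fun v _ => ?_
        by_contra h
        have h1 := hz' u v (left_ne_zero_of_mul h)
        have h2 := right_ne_zero_of_mul h
        simp only [ne_eq, ite_eq_right_iff, one_ne_zero, imp_false, not_not] at h2
        subst h2
        exact hu (hdisj _ _ _ (hA u v h1).1 (by simpa [s] using ha))
      · simp
    rw [← hsum]
    have hyz : ∀ a ∈ s, ∑ b, z₀ a b = ∑ b, (y a b + z₀ a b) := by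
      intro a _
      rw [sum_add_distrib, hycyc, zero_add]
    rw [sum_congr rfl hyz]
    have hout : ∀ a ∈ s, ∀ b, b ∉ s → y a b + z₀ a b = 0 := by
      intro a ha b hb
      simp only [s, mem_filter, mem_univ, true_and] at ha hb
      by_cases hK : K.Adj a b
      · rcases hK.2 with ⟨v, hav, hbv⟩ | ⟨u, v, huv, rfl, rfl⟩
        · exact absurd ((hdisj _ _ _ hav ha) ▸ hbv) hb
        · rw [hz₀rep u v huv, hS u v huv]
          simp only [y, if_pos hK, CharTwo.add_self_eq_zero]
      · rw [hz₀chain.zero a b hK, hy.zero a b hK, add_zero]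
    have hin : ∀ a ∈ s, ∑ b, (y a b + z₀ a b) = ∑ b ∈ s, y a b := by
      intro a ha
      rw [← sum_subset (subset_univ s) fun b _ hb => hout a ha b hb]
      refine sum_congr rfl fun b hb => ?_
      simp only [s, mem_filter, mem_univ, true_and] at ha hb
      rw [hz₀in w a b ha hb, add_zero]
    rw [sum_congr rfl hin]
    exact sum_sum_eq_zero_of_symm hy.symm fun a => hy.zero a a K.irrefl

end Minor

section Crossing

open Finset Classical

/-- A mod 2 cycle is the coboundary of a face potential vanishing at a prescribed face. -/
lemma IsDual.exists_potential [Fintype V] {F : Type} {G : SimpleGraph V} {φ : V → V → F}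
    (hφ : IsDual G φ) (f : F) {z : V → V → ZMod 2} (hz : EdgeChain G z)
    (hcyc : ∀ a, ∑ b, z a b = 0) :
    ∃ S : F → ZMod 2, S f = 0 ∧ ∀ a b, G.Adj a b → z a b = S (φ a b) + S (φ b a) := by
  obtain ⟨S, hS⟩ := (hφ z hz).1 hcyc
  refine ⟨fun g => S g + S f, CharTwo.add_self_eq_zero _, fun a b hab => ?_⟩
  rw [hS a b hab]
  linear_combination - CharTwo.add_self_eq_zero (S f)

lemma IsDual.not_crossing [Fintype V] {F : Type} {G : SimpleGraph V} {φ : V → V → F} {f : F}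
    {v₀ v₁ v₂ v₃ : V} (hφ : IsDual G φ) (h : FourFace G φ f v₀ v₁ v₂ v₃) {N : Set V}
    (h1 : v₁ ∉ N) (h3 : v₃ ∉ N) (h0 : v₀ ∈ N) (h2 : v₂ ∈ N)
    (hP : (within G N).Reachable v₀ v₂) (hQ : (within G Nᶜ).Reachable v₁ v₃) : False := by
  obtain ⟨P, hP, hPsum⟩ := exists_chain_of_reachable hP
  obtain ⟨Q, hQ, hQsum⟩ := exists_chain_of_reachable hQ
  have hwG : ∀ s, within G s ≤ G := fun s a b h => h.1
  have e := fun x => CharTwo.add_self_eq_zero (if x = v₀ then (1 : ZMod 2) else 0)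
  have e' := fun x => CharTwo.add_self_eq_zero (if x = v₁ then (1 : ZMod 2) else 0)
  have e₂ := fun x => CharTwo.add_self_eq_zero (if x = v₂ then (1 : ZMod 2) else 0)
  have e₃ := fun x => CharTwo.add_self_eq_zero (if x = v₃ then (1 : ZMod 2) else 0)
  obtain ⟨S, hSf, hS⟩ := hφ.exists_potential f
    (((hP.mono (hwG _)).add (edgeChain_edgeInd h.adj₀₁)).add (edgeChain_edgeInd h.adj₁₂))
    (fun x => by
      simp only [sum_add_distrib, hPsum, sum_edgeInd h.adj₀₁.ne, sum_edgeInd h.adj₁₂.ne]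
      linear_combination e x + e' x + e₂ x)
  obtain ⟨T, hTf, hT⟩ := hφ.exists_potential f
    (((hQ.mono (hwG _)).add (edgeChain_edgeInd h.adj₃₀)).add (edgeChain_edgeInd h.adj₀₁))
    (fun x => by
      simp only [sum_add_distrib, hQsum, sum_edgeInd h.adj₀₁.ne, sum_edgeInd h.adj₃₀.ne]
      linear_combination e x + e' x + e₃ x)
  let U : V → V → ZMod 2 := fun a b =>
    if G.Adj a b then S (φ a b) * T (φ a b) + S (φ b a) * T (φ b a) else 0
  have hU : EdgeChain G U :=
    ⟨fun a b => by simp only [U, G.adj_comm a b, add_comm], fun a b h => if_neg h⟩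
  have hUcyc := (hφ U hU).2 ⟨fun g => S g * T g, fun a b h => if_pos h⟩
  have hcross : ∀ a, a ∉ N → ∀ b ∈ N, U a b = if a = v₁ ∧ b = v₀ then 1 else 0 := by
    intro a ha b hb
    by_cases hab : G.Adj a b
    · have hSab := hS a b hab
      have hTab := hT a b hab
      have hUab : U a b = S (φ a b) * T (φ a b) + S (φ b a) * T (φ b a) := if_pos hab
      rw [hP.zero a b fun h' => ha h'.2.1, zero_add] at hSab
      rw [hQ.zero a b fun h' => h'.2.2 hb, zero_add] at hTab
      have ha0 : a ≠ v₀ := fun h' => ha (h' ▸ h0)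
      have ha2 : a ≠ v₂ := fun h' => ha (h' ▸ h2)
      have hb1 : b ≠ v₁ := fun h' => h1 (h' ▸ hb)
      have hb3 : b ≠ v₃ := fun h' => h3 (h' ▸ hb)
      simp only [edgeInd, Sym2.eq_iff, ha0, ha2, hb1, hb3, and_false, false_or,
        or_false] at hSab hTab
      have hside := h.side a b hab
      simp only [Sym2.eq_iff, ha0, ha2, hb1, hb3, and_false, false_or, or_false] at hside
      have h13 := h.ne₁₃
      have h02 := h.ne₀₂
      rw [hUab]
      by_cases hs : φ a b = f ↔ φ b a = f
      · have hn := mt hside.2 (not_not.2 hs)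
        simp only [not_or] at hn
        simp only [hn, if_false, zero_add] at hSab hTab
        rw [← CharTwo.add_eq_zero.1 hSab.symm, ← CharTwo.add_eq_zero.1 hTab.symm,
          CharTwo.add_self_eq_zero, if_neg hn.1]
      · have hST : S (φ a b) * T (φ a b) + S (φ b a) * T (φ b a) =
            (S (φ a b) + S (φ b a)) * (T (φ a b) + T (φ b a)) := by
          by_cases hf : φ a b = f
          · rw [hf, hSf, hTf]
            ring
          · have hf' : φ b a = f := by tauto
            rw [hf', hSf, hTf]
            ring
        rw [hST, ← hSab, ← hTab]
        rcases hside.1 hs with ⟨rfl, rfl⟩ | ⟨rfl, rfl⟩ | ⟨rfl, rfl⟩ | ⟨rfl, rfl⟩ <;>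
          simp [h13, h02, h13.symm, h02.symm]
    · rw [hU.zero a b hab, if_neg]
      rintro ⟨rfl, rfl⟩
      exact hab h.adj₀₁.symm
  let M : Finset V := univ.filter (· ∉ N)
  have hsum : ∑ a ∈ M, ∑ b, U a b = 0 := sum_eq_zero fun a _ => hUcyc a
  have hsplit : ∀ a ∈ M, ∑ b, U a b = ∑ b ∈ M, U a b + if a = v₁ then 1 else 0 := by
    intro a ha
    simp only [M, mem_filter, mem_univ, true_and] at ha
    rw [← sum_filter_add_sum_filter_not univ (· ∉ N)]
    congr 1
    rw [sum_congr rfl fun b hb => hcross a ha b (not_not.1 (mem_filter.1 hb).2)]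
    by_cases ha1 : a = v₁
    · simp [ha1, h0]
    · simp [ha1]
  rw [sum_congr rfl hsplit, sum_add_distrib,
    sum_sum_eq_zero_of_symm hU.symm fun a => hU.zero a a G.irrefl] at hsum
  simp [M, h1] at hsum

end Crossing

section Glue

open Finset Classical

/-- Identify `y` with `x`; the vertex `y` becomes isolated. -/
noncomputable def glueMap (x y : V) : V → V := Function.update id y x

/-- The graph obtained from `G` by identifying `y` with `x`. -/
noncomputable def glue (G : SimpleGraph V) (x y : V) : SimpleGraph V where
  Adj a b := a ≠ b ∧ ∃ a' b', G.Adj a' b' ∧ glueMap x y a' = a ∧ glueMap x y b' = b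
  symm := ⟨fun _ _ h => ⟨h.1.symm, let ⟨a', b', h', ha, hb⟩ := h.2; ⟨b', a', h'.symm, hb, ha⟩⟩⟩
  loopless := ⟨fun _ h => h.1 rfl⟩

lemma glueMap_self (x y : V) : glueMap x y y = x := by simp [glueMap]

lemma glueMap_of_ne (x : V) {y a : V} (h : a ≠ y) : glueMap x y a = a := by simp [glueMap, h]

lemma glueMap_eq {x y a v : V} (h : glueMap x y a = v) : a = v ∨ a = y ∧ v = x := by
  by_cases ha : a = y
  · rw [ha, glueMap_self] at h
    exact Or.inr ⟨ha, h.symm⟩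
  · rw [glueMap_of_ne x ha] at h
    exact Or.inl h

lemma glue_adj_map {G : SimpleGraph V} {x y : V} (hxy : ¬ G.Adj x y) {a b : V} (h : G.Adj a b) :
    (glue G x y).Adj (glueMap x y a) (glueMap x y b) := by
  refine ⟨fun he => ?_, a, b, h, rfl, rfl⟩
  by_cases ha : a = y
  · subst ha
    rw [glueMap_self, glueMap_of_ne x h.ne'] at he
    exact hxy (he ▸ h.symm)
  · by_cases hb : b = y
    · subst hb
      rw [glueMap_self, glueMap_of_ne x ha] at he
      exact hxy (he ▸ h)
    · rw [glueMap_of_ne x ha, glueMap_of_ne x hb] at he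
      exact h.ne he

lemma IsDual.hasDual_glue [Fintype V] {F : Type} {G : SimpleGraph V} {φ : V → V → F} {f : F}
    {v₀ v₁ v₂ v₃ : V} (hφ : IsDual G φ) (h : FourFace G φ f v₀ v₁ v₂ v₃)
    (h02 : ¬ G.Adj v₀ v₂) : HasDual (glue G v₀ v₂) := by
  have : Nonempty V := ⟨v₀⟩
  refine (hφ.chord h h02).minor (fun u => {a | glueMap v₀ v₂ a = u})
    (fun u v a hu hv => hu.symm.trans hv) ?_ ?_
  · rintro v a ha b hb
    by_cases hab : a = b
    · rw [hab]
    · refine SimpleGraph.Adj.reachable ⟨?_, ha, hb⟩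
      rw [SimpleGraph.sup_adj, SimpleGraph.edge_adj]
      rcases glueMap_eq ha with h1 | ⟨h1, h1'⟩ <;> rcases glueMap_eq hb with h2 | ⟨h2, h2'⟩ <;>
        subst_vars <;> simp_all
  · rintro u v ⟨-, a, b, hab, ha, hb⟩
    exact ⟨a, ha, b, hb, Or.inl hab⟩

lemma darts_glue_lt [Fintype V] {G : SimpleGraph V} {x y v : V} (hxy : x ≠ y) (hx : G.Adj x v)
    (hy : G.Adj y v) : #(darts (glue G x y) univ) < #(darts G univ) := by
  have hsub : darts (glue G x y) univ ⊆
      (darts G univ).image (Prod.map (glueMap x y) (glueMap x y)) := by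
    rintro ⟨a, b⟩ hab
    obtain ⟨-, -, -, a', b', h, ha, hb⟩ := mem_darts.1 hab
    exact mem_image.2 ⟨(a', b'), mem_darts.2 ⟨mem_univ _, mem_univ _, h⟩, Prod.ext ha hb⟩
  refine (card_le_card hsub).trans_lt (lt_of_le_of_ne card_image_le fun he => ?_)
  have hinj := card_image_iff.1 he
  have h1 : (x, v) ∈ darts G univ := mem_darts.2 ⟨mem_univ _, mem_univ _, hx⟩
  have h2 : (y, v) ∈ darts G univ := mem_darts.2 ⟨mem_univ _, mem_univ _, hy⟩
  have := hinj h1 h2 (by simp [glueMap_self, glueMap_of_ne x hxy])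
  exact hxy (congrArg Prod.fst this)

/-- Triangle-freeness in elementary form. -/
def TriFree (G : SimpleGraph V) : Prop := ∀ a b c, G.Adj a b → G.Adj b c → G.Adj c a → False

lemma TriFree.triFree_glue {G : SimpleGraph V} {x y : V} (hG : TriFree G)
    (hpath : ∀ p q, G.Adj x p → G.Adj p q → G.Adj q y → False) : TriFree (glue G x y) := by
  have key : ∀ b c, (glue G x y).Adj x b → (glue G x y).Adj b c → (glue G x y).Adj c x → False := by
    rintro b c ⟨hxb, a₁, b₁, h1, ha1, hb1⟩ ⟨hbc, b₂, c₂, h2, hb2, hc2⟩ ⟨hcx, c₃, a₃, h3, hc3, ha3⟩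
    have lift : ∀ {w w'}, w ≠ x → glueMap x y w' = w → w' = w := fun hw hw' =>
      (glueMap_eq hw').resolve_right fun h => hw h.2
    obtain rfl := lift hxb.symm hb1
    obtain rfl := lift hxb.symm hb2
    obtain rfl := lift hcx hc2
    obtain rfl := lift hcx hc3
    rcases glueMap_eq ha1 with rfl | ⟨rfl, -⟩ <;> rcases glueMap_eq ha3 with rfl | ⟨rfl, -⟩
    · exact hG _ _ _ h1 h2 h3
    · exact hpath _ _ h1 h2 h3
    · exact hpath _ _ h3.symm h2.symm h1.symm
    · exact hG _ _ _ h1 h2 h3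
  intro a b c hab hbc hca
  by_cases ha : a = x
  · subst ha
    exact key b c hab hbc hca
  by_cases hb : b = x
  · subst hb
    exact key c a hbc hca hab
  by_cases hc : c = x
  · subst hc
    exact key a b hca hab hbc
  have lift : ∀ {w w'}, w ≠ x → (glue G x y).Adj w w' → w' ≠ x → G.Adj w w' := by
    rintro w w' hw ⟨-, s, t, hst, hs, ht⟩ hw'
    rw [← (glueMap_eq hs).resolve_right fun h => hw h.2,
      ← (glueMap_eq ht).resolve_right fun h => hw' h.2]
    exact hst
  exact hG a b c (lift ha hab hb) (lift hb hbc hc) (lift hc hca ha)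

end Glue

section Euler

open Finset Classical

lemma ten_le_darts_or_four_cycle [Fintype V] {K : SimpleGraph V} (hK : TriFree K)
    (hev : ∀ a b, K.Adj a b → ∃ c, c ≠ b ∧ K.Adj a c) {a b : V} (hab : K.Adj a b) :
    10 ≤ #(darts K univ) ∨ ∃ c d, K.Adj b c ∧ K.Adj c d ∧ K.Adj d a ∧ a ≠ c ∧ b ≠ d ∧
      ∀ p q, K.Adj p q → s(p, q) = s(a, b) ∨ s(p, q) = s(b, c) ∨ s(p, q) = s(c, d) ∨
        s(p, q) = s(d, a) := by
  let X : Finset V := univ.filter fun v => ∃ w, K.Adj v w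
  have hX : ∀ {v w}, K.Adj v w → v ∈ X := fun {v w} h => mem_filter.2 ⟨mem_univ _, w, h⟩
  by_cases hc : 5 ≤ #X
  · left
    calc 10 ≤ #X * 2 := by omega
      _ = ∑ v ∈ X, 2 := by rw [sum_const, smul_eq_mul]
      _ ≤ ∑ v ∈ X, #(univ.filter (K.Adj v)) := by
          refine sum_le_sum fun v hv => ?_
          obtain ⟨w, hw⟩ := (mem_filter.1 hv).2
          obtain ⟨c, hc, hvc⟩ := hev v w hw
          exact one_lt_card.2 ⟨w, by simp [hw], c, by simp [hvc], hc.symm⟩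
      _ ≤ ∑ v, #(univ.filter (K.Adj v)) := sum_le_sum_of_subset (subset_univ _)
      _ = #(darts K univ) := (darts_card_eq_sum K univ).symm
  · right
    obtain ⟨c, hca, hbc⟩ := hev b a hab.symm
    obtain ⟨d, hdb, had⟩ := hev a b hab
    have hcd : c ≠ d := by
      rintro rfl
      exact hK a b c hab hbc had.symm
    have hsub : ({a, b, c, d} : Finset V) ⊆ X := by
      simp only [insert_subset_iff, singleton_subset_iff]
      exact ⟨hX hab, hX hab.symm, hX hbc.symm, hX had.symm⟩
    have hcard : #({a, b, c, d} : Finset V) = 4 := by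
      rw [card_insert_of_notMem, card_insert_of_notMem, card_pair hcd] <;>
        simp [hab.ne, hca.symm, had.ne, hbc.ne, hdb.symm]
    have hXeq := eq_of_subset_of_card_le hsub (by omega)
    have hmem : ∀ {v w}, K.Adj v w → v = a ∨ v = b ∨ v = c ∨ v = d := fun h => by
      simpa [← hXeq] using hX h
    have hac : ¬ K.Adj a c := fun h => hK a b c hab hbc h.symm
    have hbd : ¬ K.Adj b d := fun h => hK a b d hab h had.symm
    have hcd' : K.Adj c d := by
      obtain ⟨w, hwb, hcw⟩ := hev c b hbc.symm
      rcases hmem hcw.symm with rfl | rfl | rfl | rfl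
      · exact absurd hcw.symm hac
      · exact absurd rfl hwb
      · exact absurd hcw K.irrefl
      · exact hcw
    refine ⟨c, d, hbc, hcd', had.symm, hca.symm, hdb.symm, fun p q hpq => ?_⟩
    rcases hmem hpq with rfl | rfl | rfl | rfl <;>
      rcases hmem hpq.symm with rfl | rfl | rfl | rfl <;>
      first
      | exact absurd hpq K.irrefl
      | exact absurd hpq hac
      | exact absurd hpq hbd
      | exact absurd hpq.symm hac
      | exact absurd hpq.symm hbd
      | simp

/-- The edges of `G` with exactly one side equal to `f`. -/
def faceBoundary {F : Type} (G : SimpleGraph V) (φ : V → V → F) (f : F) : SimpleGraph V where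
  Adj a b := G.Adj a b ∧ ¬ (φ a b = f ↔ φ b a = f)
  symm := ⟨fun _ _ h => ⟨h.1.symm, fun h' => h.2 h'.symm⟩⟩
  loopless := ⟨fun _ h => h.1.ne rfl⟩

lemma IsDual.exists_other_boundary_neighbor [Fintype V] {F : Type} {G : SimpleGraph V}
    {φ : V → V → F} (hφ : IsDual G φ) (f : F) (a b : V) (hab : (faceBoundary G φ f).Adj a b) :
    ∃ c, c ≠ b ∧ (faceBoundary G φ f).Adj a c := by
  by_contra! hno
  let z : V → V → ZMod 2 := fun a b => if (faceBoundary G φ f).Adj a b then 1 else 0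
  have hz : EdgeChain G z :=
    ⟨fun a b => by simp only [z, SimpleGraph.adj_comm _ a b], fun a b h => if_neg fun h' => h h'.1⟩
  have h0 := (hφ z hz).2 ⟨fun g => if g = f then 1 else 0, fun a b hab => by
    by_cases h1 : φ a b = f <;> by_cases h2 : φ b a = f <;>
      simp [z, faceBoundary, hab, h1, h2, CharTwo.add_self_eq_zero]⟩ a
  rw [sum_eq_single b (fun c _ hc => if_neg (hno c hc)) (by simp)] at h0
  simp [hab] at h0

lemma IsDual.ten_le_boundary [Fintype V] {F : Type} {G : SimpleGraph V} {φ : V → V → F}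
    (hφ : IsDual G φ) (hG : TriFree G) (h4 : ∀ f v₀ v₁ v₂ v₃, ¬ FourFace G φ f v₀ v₁ v₂ v₃)
    {f : F} {a b : V} (hab : (faceBoundary G φ f).Adj a b) :
    10 ≤ #(darts (faceBoundary G φ f) univ) := by
  refine (ten_le_darts_or_four_cycle (K := faceBoundary G φ f)
    (fun a b c h1 h2 h3 => hG a b c h1.1 h2.1 h3.1) (hφ.exists_other_boundary_neighbor f)
      hab).resolve_right ?_
  rintro ⟨c, d, hbc, hcd, hda, hac, hbd, hall⟩
  refine h4 f a b c d ⟨hab.1, hbc.1, hcd.1, hda.1, hac, hbd, fun p q hpq => ⟨fun h =>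
    hall p q ⟨hpq, h⟩, fun h => ?_⟩⟩
  suffices (faceBoundary G φ f).Adj p q from this.2
  rw [← SimpleGraph.mem_edgeSet]
  rcases h with h | h | h | h <;> rw [h] <;> assumption

/-- The faces on exactly one side of some edge. -/
noncomputable def innerFaces [Fintype V] {F : Type} (G : SimpleGraph V) (φ : V → V → F) :
    Finset F :=
  ((darts G univ).filter fun p => φ p.1 p.2 ≠ φ p.2 p.1).image fun p => φ p.1 p.2

lemma mem_innerFaces [Fintype V] {F : Type} {G : SimpleGraph V} {φ : V → V → F} {f : F} :
    f ∈ innerFaces G φ ↔ ∃ a b, G.Adj a b ∧ φ a b = f ∧ φ b a ≠ f := by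
  simp only [innerFaces, mem_image, mem_filter, mem_darts, mem_univ, true_and, Prod.exists]
  constructor
  · rintro ⟨a, b, ⟨h1, h2⟩, rfl⟩
    exact ⟨a, b, h1, rfl, h2.symm⟩
  · rintro ⟨a, b, h1, rfl, h2⟩
    exact ⟨a, b, ⟨h1, h2.symm⟩, rfl⟩

lemma IsDual.ten_mul_card_innerFaces_le [Fintype V] {F : Type} {G : SimpleGraph V}
    {φ : V → V → F} (hφ : IsDual G φ) (hG : TriFree G)
    (h4 : ∀ f v₀ v₁ v₂ v₃, ¬ FourFace G φ f v₀ v₁ v₂ v₃) :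
    10 * #(innerFaces G φ) ≤ 2 * #(darts G univ) := by
  calc 10 * #(innerFaces G φ) = ∑ f ∈ innerFaces G φ, 10 := by
        rw [sum_const, smul_eq_mul, mul_comm]
    _ ≤ ∑ f ∈ innerFaces G φ, #(darts (faceBoundary G φ f) univ) := by
        refine sum_le_sum fun f hf => ?_
        obtain ⟨a, b, hab, h1, h2⟩ := mem_innerFaces.1 hf
        exact hφ.ten_le_boundary hG h4 (a := a) (b := b) ⟨hab, by simp [h1, h2]⟩
    _ ≤ ∑ f ∈ innerFaces G φ,
          #((darts G univ).filter fun p => φ p.1 p.2 = f ∨ φ p.2 p.1 = f) := by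
        refine sum_le_sum fun f _ => card_le_card fun p hp => ?_
        obtain ⟨-, -, h1, h2⟩ := mem_darts.1 hp
        refine mem_filter.2 ⟨mem_darts.2 ⟨mem_univ _, mem_univ _, h1⟩, ?_⟩
        by_contra h
        exact h2 (by tauto)
    _ = ∑ p ∈ darts G univ, #((innerFaces G φ).filter fun f => φ p.1 p.2 = f ∨ φ p.2 p.1 = f) := by
        simp only [card_filter]
        exact sum_comm
    _ ≤ ∑ p ∈ darts G univ, 2 := by
        refine sum_le_sum fun p _ => (card_le_card ?_).trans (card_le_two (a := φ p.1 p.2)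
          (b := φ p.2 p.1))
        intro f hf
        rw [mem_filter] at hf
        simpa [eq_comm] using hf.2
    _ = 2 * #(darts G univ) := by rw [sum_const, smul_eq_mul, mul_comm]

/-- The chain with prescribed values on edges. -/
noncomputable def chainOfEdges (G : SimpleGraph V) :
    (G.edgeSet → ZMod 2) →ₗ[ZMod 2] (V → V → ZMod 2) where
  toFun x a b := if h : G.Adj a b then x ⟨s(a, b), h⟩ else 0
  map_add' x y := by
    ext a b
    by_cases h : G.Adj a b <;> simp [h]
  map_smul' t x := by
    ext a b
    by_cases h : G.Adj a b <;> simp [h]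

lemma edgeChain_chainOfEdges (G : SimpleGraph V) (x : G.edgeSet → ZMod 2) :
    EdgeChain G (chainOfEdges G x) := by
  refine ⟨fun a b => ?_, fun a b h => dif_neg h⟩
  simp only [chainOfEdges, LinearMap.coe_mk, AddHom.coe_mk, G.adj_comm a b,
    Sym2.eq_swap (a := a)]

lemma chainOfEdges_injective (G : SimpleGraph V) : Function.Injective (chainOfEdges G) := by
  intro x y hxy
  ext ⟨e, he⟩
  induction e with
  | _ a b =>
    have := congrFun (congrFun hxy a) b
    simpa [chainOfEdges, show G.Adj a b from he] using this

/-- The boundary map restricted to a set of vertices. -/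
noncomputable def boundaryMap [Fintype V] (R : Finset V) :
    (V → V → ZMod 2) →ₗ[ZMod 2] (R → ZMod 2) where
  toFun z a := ∑ b, z a b
  map_add' x y := by
    ext a
    simp [sum_add_distrib]
  map_smul' t x := by
    ext a
    simp [mul_sum]

/-- The chain of a potential on a finite set of faces. -/
noncomputable def cutMap {F : Type} (G : SimpleGraph V) (φ : V → V → F) (Φ : Finset F) :
    (Φ → ZMod 2) →ₗ[ZMod 2] (V → V → ZMod 2) where
  toFun S a b := if G.Adj a b ∧ φ a b ≠ φ b a then
    (if h : φ a b ∈ Φ then S ⟨_, h⟩ else 0) + (if h : φ b a ∈ Φ then S ⟨_, h⟩ else 0) else 0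
  map_add' x y := by
    ext a b
    simp only [Pi.add_apply]
    split_ifs <;> ring
  map_smul' t x := by
    ext a b
    simp only [Pi.smul_apply, smul_eq_mul, RingHom.id_apply]
    split_ifs <;> ring

lemma card_darts_eq [Fintype V] (G : SimpleGraph V) :
    #(darts G univ) = 2 * Fintype.card G.edgeSet := by
  rw [← SimpleGraph.edgeFinset_card, ← SimpleGraph.sum_degrees_eq_twice_card_edges,
    darts_card_eq_sum]
  refine sum_congr rfl fun a _ => ?_
  rw [← SimpleGraph.card_neighborFinset_eq_degree]
  congr 1
  ext b
  simp

lemma IsDual.card_edges_le [Fintype V] {F : Type} {G : SimpleGraph V} {φ : V → V → F}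
    (hφ : IsDual G φ) {R : Finset V} (hR : R.Nonempty) (hGR : ∀ a b, G.Adj a b → a ∈ R) :
    Fintype.card G.edgeSet + 1 ≤ #R + (#(innerFaces G φ) - 1) := by
  let D : (G.edgeSet → ZMod 2) →ₗ[ZMod 2] (R → ZMod 2) := boundaryMap R ∘ₗ chainOfEdges G
  have hrank := D.finrank_range_add_finrank_ker
  rw [Module.finrank_pi] at hrank
  have h1 : Module.finrank (ZMod 2) (LinearMap.range D) + 1 ≤ #R := by
    let σ : (R → ZMod 2) →ₗ[ZMod 2] ZMod 2 := ∑ a, LinearMap.proj a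
    have hσ : ∀ x, σ x = ∑ a, x a := fun x => by simp [σ]
    have hle : LinearMap.range D ≤ LinearMap.ker σ := by
      rintro _ ⟨x, rfl⟩
      rw [LinearMap.mem_ker, hσ]
      have hz := edgeChain_chainOfEdges G x
      have h2 : ∑ a : R, D x a = ∑ a : R, ∑ b, chainOfEdges G x a b := rfl
      rw [h2, sum_coe_sort R fun a => ∑ b, chainOfEdges G x a b,
        sum_subset (subset_univ R) fun a _ ha => sum_eq_zero fun b _ =>
        hz.zero a b fun h => ha (hGR a b h)]
      exact sum_sum_eq_zero_of_symm hz.symm fun a => hz.zero a a G.irrefl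
    have hsurj : Function.Surjective σ := by
      obtain ⟨v, hv⟩ := hR
      intro t
      exact ⟨Pi.single ⟨v, hv⟩ t, by simp [hσ]⟩
    have h3 := σ.finrank_range_add_finrank_ker
    rw [Module.finrank_pi, LinearMap.range_eq_top.2 hsurj, finrank_top, Module.finrank_self,
      Fintype.card_coe] at h3
    have h5 := Submodule.finrank_mono hle
    omega
  have h2 : Module.finrank (ZMod 2) (LinearMap.ker D) ≤ #(innerFaces G φ) - 1 := by
    let δ := cutMap G φ (innerFaces G φ)
    have hsub : (LinearMap.ker D).map (chainOfEdges G) ≤ LinearMap.range δ := by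
      rintro _ ⟨x, hx, rfl⟩
      have hz := edgeChain_chainOfEdges G x
      have hcyc : ∀ a, ∑ b, chainOfEdges G x a b = 0 := by
        intro a
        by_cases ha : a ∈ R
        · exact congrFun (LinearMap.mem_ker.1 hx) ⟨a, ha⟩
        · exact sum_eq_zero fun b _ => hz.zero a b fun h => ha (hGR a b h)
      obtain ⟨S, hS⟩ := (hφ _ hz).1 hcyc
      refine ⟨fun f => S f, ?_⟩
      ext a b
      by_cases hab : G.Adj a b
      · rw [hS a b hab]
        by_cases h : φ a b = φ b a
        · simp [δ, cutMap, h, CharTwo.add_self_eq_zero]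
        · have ha : φ a b ∈ innerFaces G φ := mem_innerFaces.2 ⟨a, b, hab, rfl, Ne.symm h⟩
          have hb : φ b a ∈ innerFaces G φ := mem_innerFaces.2 ⟨b, a, hab.symm, rfl, h⟩
          simp [δ, cutMap, hab, h, ha, hb]
      · rw [hz.zero a b hab]
        simp [δ, cutMap, hab]
    have h3 := δ.finrank_range_add_finrank_ker
    rw [Module.finrank_pi, Fintype.card_coe] at h3
    have h4 := Submodule.finrank_mono hsub
    rw [← (Submodule.equivMapOfInjective _ (chainOfEdges_injective G) _).finrank_eq] at h4
    by_cases hne : (innerFaces G φ).Nonempty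
    · have : 0 < Module.finrank (ZMod 2) (LinearMap.ker δ) := by
        have : (fun _ => 1 : innerFaces G φ → ZMod 2) ∈ LinearMap.ker δ := by
          rw [LinearMap.mem_ker]
          ext a b
          simp only [δ, cutMap, LinearMap.coe_mk, AddHom.coe_mk, Pi.zero_apply]
          split_ifs with h1 h2 h3 h3
          · exact CharTwo.add_self_eq_zero _
          · exact absurd (mem_innerFaces.2 ⟨b, a, h1.1.symm, rfl, h1.2⟩) h3
          · exact absurd (mem_innerFaces.2 ⟨a, b, h1.1, rfl, h1.2.symm⟩) h2
          · simp
          · rfl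
        obtain ⟨f, hf⟩ := hne
        refine Module.finrank_pos_iff_exists_ne_zero.2 ⟨⟨_, this⟩, fun h => ?_⟩
        have := congrFun (congrArg Subtype.val h) ⟨f, hf⟩
        simp at this
      omega
    · have := card_eq_zero.2 (not_nonempty_iff_eq_empty.1 hne)
      omega
  omega

lemma IsDual.euler [Fintype V] {F : Type} {G : SimpleGraph V} {φ : V → V → F}
    (hφ : IsDual G φ) (hG : TriFree G) (h4 : ∀ f v₀ v₁ v₂ v₃, ¬ FourFace G φ f v₀ v₁ v₂ v₃)
    {R : Finset V} (hR : R.Nonempty) (hGR : ∀ a b, G.Adj a b → a ∈ R) :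
    3 * #(darts G univ) + 20 ≤ 10 * #R ∨ #(darts G univ) + 2 ≤ 2 * #R := by
  have h1 := hφ.card_edges_le hR hGR
  have h2 := hφ.ten_mul_card_innerFaces_le hG h4
  have h3 := card_darts_eq G
  omega

end Euler

section Main

open Finset Classical

lemma darts_lt [Fintype V] {G G' : SimpleGraph V} (h : G' ≤ G) {a b : V} (hab : G.Adj a b)
    (hab' : ¬ G'.Adj a b) : #(darts G' univ) < #(darts G univ) := by
  refine card_lt_card ⟨darts_mono h (Subset.refl _), fun hsub => hab' ?_⟩
  have hmem : (a, b) ∈ darts G univ := mem_darts.2 ⟨mem_univ _, mem_univ _, hab⟩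
  exact (mem_darts.1 (hsub hmem)).2.2

lemma within_le (G : SimpleGraph V) (s : Set V) : within G s ≤ G := fun _ _ h => h.1

lemma TriFree.mono {G G' : SimpleGraph V} (h : TriFree G) (hle : G' ≤ G) : TriFree G' :=
  fun a b c hab hbc hca => h a b c (hle hab) (hle hbc) (hle hca)

lemma reachable_of_three_path {G : SimpleGraph V} {N : Set V} {a b c d : V} (hab : G.Adj a b)
    (hbc : G.Adj b c) (hcd : G.Adj c d) (ha : a ∈ N) (hb : b ∈ N) (hc : c ∈ N) (hd : d ∈ N) :
    (within G N).Reachable a d := by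
  have h1 : (within G N).Adj a b := ⟨hab, ha, hb⟩
  have h2 : (within G N).Adj b c := ⟨hbc, hb, hc⟩
  have h3 : (within G N).Adj c d := ⟨hcd, hc, hd⟩
  exact h1.reachable.trans (h2.reachable.trans h3.reachable)

lemma FourFace.notMem_path {F : Type} {G : SimpleGraph V} {φ : V → V → F} {f : F}
    {v₀ v₁ v₂ v₃ : V} (h : FourFace G φ f v₀ v₁ v₂ v₃) (hG : TriFree G) {p q : V}
    (h0p : G.Adj v₀ p) (hpq : G.Adj p q) (hq2 : G.Adj q v₂) :
    v₁ ∉ ({v₀, v₂, p, q} : Set V) ∧ v₃ ∉ ({v₀, v₂, p, q} : Set V) := by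
  simp only [Set.mem_insert_iff, Set.mem_singleton_iff, not_or]
  refine ⟨⟨h.adj₀₁.ne', h.adj₁₂.ne, ?_, ?_⟩, ⟨h.adj₃₀.ne, h.adj₂₃.ne', ?_, ?_⟩⟩ <;> rintro rfl
  · exact hG _ _ _ hpq hq2 h.adj₁₂.symm
  · exact hG _ _ _ h0p hpq h.adj₀₁.symm
  · exact hG _ _ _ hpq hq2 h.adj₂₃
  · exact hG _ _ _ h0p hpq h.adj₃₀

lemma IsDual.not_two_paths [Fintype V] {F : Type} {G : SimpleGraph V} {φ : V → V → F} {f : F}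
    {v₀ v₁ v₂ v₃ : V} (hφ : IsDual G φ) (hG : TriFree G) (h : FourFace G φ f v₀ v₁ v₂ v₃)
    {p q r s : V} (h0p : G.Adj v₀ p) (hpq : G.Adj p q) (hq2 : G.Adj q v₂)
    (h1r : G.Adj v₁ r) (hrs : G.Adj r s) (hs3 : G.Adj s v₃) : False := by
  obtain ⟨h1, h3⟩ := h.notMem_path hG h0p hpq hq2
  refine hφ.not_crossing h h1 h3 (by simp) (by simp)
    (reachable_of_three_path h0p hpq hq2 (by simp) (by simp) (by simp) (by simp))
    (reachable_of_three_path h1r hrs hs3 h1 ?_ ?_ h3)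
  all_goals
    simp only [Set.mem_compl_iff, Set.mem_insert_iff, Set.mem_singleton_iff, not_or]
    refine ⟨?_, ?_, ?_, ?_⟩ <;> rintro rfl
  · exact hG _ _ _ hrs hs3 h.adj₃₀
  · exact hG _ _ _ hrs hs3 h.adj₂₃.symm
  · exact hG _ _ _ h1r h0p.symm h.adj₀₁
  · exact hG _ _ _ h1r hq2 h.adj₁₂.symm
  · exact hG _ _ _ h1r hrs h.adj₀₁
  · exact hG _ _ _ h1r hrs h.adj₁₂.symm
  · exact hG _ _ _ h0p hs3 h.adj₃₀
  · exact hG _ _ _ hs3 h.adj₂₃.symm hq2.symm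

lemma FourFace.not_adj₀₂ {F : Type} {G : SimpleGraph V} {φ : V → V → F} {f : F}
    {v₀ v₁ v₂ v₃ : V} (h : FourFace G φ f v₀ v₁ v₂ v₃) (hG : TriFree G) : ¬ G.Adj v₀ v₂ :=
  fun h' => hG _ _ _ h' h.adj₂₃ h.adj₃₀

/-- `G` together with one more vertex adjacent to the vertices in `N`. -/
def addVertex (G : SimpleGraph V) (N : Finset V) : SimpleGraph (Option V) where
  Adj
    | some a, some b => G.Adj a b
    | some a, none => a ∈ N
    | none, some b => b ∈ N
    | none, none => False
  symm := ⟨by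
    rintro (_ | a) (_ | b) h
    · exact h
    · exact h
    · exact h
    · exact G.symm.symm _ _ h⟩
  loopless := ⟨by
    rintro (_ | a) h
    · exact h
    · exact G.irrefl h⟩

lemma pot_addVertex_le [Fintype V] {G : SimpleGraph V} {N : Finset V} (hN : #N ≤ 4)
    {R : Finset (Option V)} (hpot : pot (addVertex G N) R ≤ 4) (hR : 4 ≤ #R)
    (hd : 3 * #(darts G univ) + 20 ≤ 10 * #(univ.filter fun v => some v ∈ R) ∨
      #(darts G univ) + 2 ≤ 2 * #(univ.filter fun v => some v ∈ R)) : False := by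
  set R₀ := univ.filter fun v => some v ∈ R with hR₀
  let N' := N.filter fun v => none ∈ R ∧ some v ∈ R
  have hN1 : #N' ≤ 4 := (card_filter_le _ _).trans hN
  have hN2 : #N' ≤ #R₀ := card_le_card fun v hv =>
    mem_filter.2 ⟨mem_univ _, (mem_filter.1 hv).2.2⟩
  have hmap : R₀.map Function.Embedding.some = R.erase none := by
    ext (_ | v) <;> simp [R₀]
  have hcard := congrArg card hmap
  rw [card_map] at hcard
  have hsub : darts (addVertex G N) R ⊆ (darts G univ).image (Prod.map some some) ∪
      (N'.image (fun v => (none, some v)) ∪ N'.image fun v => (some v, none)) := by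
    rintro ⟨_ | a, _ | b⟩ hab <;> obtain ⟨h1, h2, h3⟩ := mem_darts.1 hab
    · exact h3.elim
    · refine mem_union_right _ (mem_union_left _ (mem_image_of_mem _ ?_))
      exact mem_filter.2 ⟨h3, h1, h2⟩
    · refine mem_union_right _ (mem_union_right _ (mem_image_of_mem _ ?_))
      exact mem_filter.2 ⟨h3, h2, h1⟩
    · exact mem_union_left _ (mem_image.2 ⟨(a, b), mem_darts.2 ⟨mem_univ _, mem_univ _, h3⟩, rfl⟩)
  have hle := (card_le_card hsub).trans ((card_union_le _ _).trans (add_le_add card_image_le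
    ((card_union_le _ _).trans (add_le_add card_image_le card_image_le))))
  unfold pot at hpot
  by_cases hn : none ∈ R
  · rw [card_erase_of_mem hn] at hcard
    omega
  · rw [erase_eq_of_notMem hn] at hcard
    have : #N' = 0 := by simp [N', hn]
    omega

/-- Up to four vertices of a triangle-free graph with an algebraic dual can simultaneously avoid
one color in a proper 3-coloring. -/
lemma exists_coloring_avoiding [Fintype V] {G : SimpleGraph V} (hdual : HasDual G)
    (hG : TriFree G) {N : Finset V} (hN : #N ≤ 4) :
    ∃ c : V → Fin 3, (∀ a b, G.Adj a b → c a ≠ c b) ∧ ∃ k, ∀ v ∈ N, c v ≠ k := by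
  induction hm : #(darts G univ) using Nat.strong_induction_on generalizing G N with
  | _ m ih =>
  subst hm
  by_contra hno
  have hnc : ¬ ColOn (addVertex G N) univ := by
    rintro ⟨c, hc⟩
    exact hno ⟨fun v => c (some v), fun a b hab => hc _ (mem_univ _) _ (mem_univ _) hab,
      c none, fun v hv => hc (some v) (mem_univ _) none (mem_univ _) hv⟩
  obtain ⟨R, -, hR, hpot⟩ := kostochka_yancey _ _ hnc
  have hR4 := four_le_card_of_not_colOn hR
  set R₀ : Finset V := univ.filter fun v => some v ∈ R with hR₀
  have hin : ∀ a b, G.Adj a b → a ∈ R₀ := by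
    by_contra! hout
    obtain ⟨a, b, hab, ha⟩ := hout
    obtain ⟨c, hc, k, hk⟩ := ih _ (darts_lt (within_le G R₀) hab fun h => ha h.2.1)
      (hdual.mono (within_le G R₀)) (hG.mono (within_le G R₀)) hN rfl
    refine hR ⟨fun o => o.elim k c, ?_⟩
    rintro (_ | u) hu (_ | w) hw huw
    · exact huw.elim
    · exact (hk w huw).symm
    · exact hk u huw
    · exact hc u w ⟨huw, by simpa [R₀] using hu, by simpa [R₀] using hw⟩
  obtain ⟨F, φ, hφ⟩ := hdual
  by_cases h4 : ∀ f v₀ v₁ v₂ v₃, ¬ FourFace G φ f v₀ v₁ v₂ v₃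
  · have hne : R₀.Nonempty := by
      obtain ⟨x, hx, y, hy, hxy⟩ := one_lt_card.1 (show 1 < #R by omega)
      rcases x with _ | x
      · rcases y with _ | y
        · exact absurd rfl hxy
        · exact ⟨y, by simpa [R₀] using hy⟩
      · exact ⟨x, by simpa [R₀] using hx⟩
    exact pot_addVertex_le hN hpot hR4 (hφ.euler hG h4 hne hin)
  · push Not at h4
    obtain ⟨f, v₀, v₁, v₂, v₃, h⟩ := h4
    have path : ∀ {w₀ w₁ w₂ w₃}, FourFace G φ f w₀ w₁ w₂ w₃ →
        ∃ p q, G.Adj w₀ p ∧ G.Adj p q ∧ G.Adj q w₂ := by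
      intro w₀ w₁ w₂ w₃ hw
      by_contra! hp
      have h02 := hw.not_adj₀₂ hG
      obtain ⟨c, hc, k, hk⟩ := ih _ (darts_glue_lt hw.ne₀₂ hw.adj₀₁ hw.adj₁₂.symm)
        (hφ.hasDual_glue hw h02) (hG.triFree_glue hp)
        ((card_image_le (s := N) (f := glueMap w₀ w₂)).trans hN) rfl
      exact hno ⟨fun v => c (glueMap w₀ w₂ v), fun a b hab => hc _ _ (glue_adj_map h02 hab), k,
        fun v hv => hk _ (mem_image_of_mem _ hv)⟩
    obtain ⟨p, q, h0p, hpq, hq2⟩ := path h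
    obtain ⟨r, s, h1r, hrs, hs3⟩ := path h.rotate
    exact hφ.not_two_paths hG h h0p hpq hq2 h1r hrs hs3

lemma fin_three_eq : ∀ a b c d : Fin 3, a ≠ c → b ≠ c → a ≠ d → b ≠ d → c ≠ d → a = b := by
  decide

lemma exists_injective_fin_three {a b c a' b' c' : Fin 3} (hab : a ≠ b) (hac : a ≠ c)
    (hbc : b ≠ c) (hab' : a' ≠ b') (hac' : a' ≠ c') (hbc' : b' ≠ c') :
    ∃ π : Fin 3 → Fin 3, Function.Injective π ∧ π a = a' ∧ π b = b' ∧ π c = c' := by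
  have hall : ∀ t, t = a ∨ t = b ∨ t = c := by
    intro t
    by_contra! h
    exact h.2.2 (fin_three_eq t c a b h.1 hac.symm h.2.1 hbc.symm hab)
  refine ⟨fun t => if t = a then a' else if t = b then b' else c', fun s t hst => ?_, by simp,
    by simp [hab.symm], by simp [hac.symm, hbc.symm]⟩
  rcases hall s with h | h | h <;> rcases hall t with h' | h' | h' <;>
    simp [h, h', hab.symm, hac.symm, hbc.symm, hab', hab'.symm, hac', hac'.symm,
      hbc', hbc'.symm] at hst ⊢

/-- If an opposite pair of a 4-face is joined by a path of length three, then the other opposite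
pair can be given distinct colors. -/
lemma IsDual.exists_coloring_opposite_ne [Fintype V] {F : Type} {G : SimpleGraph V}
    {φ : V → V → F} {f : F} {v₀ v₁ v₂ v₃ : V} (hφ : IsDual G φ) (hG : TriFree G)
    (h : FourFace G φ f v₀ v₁ v₂ v₃) {x y : V} (h0x : G.Adj v₀ x) (hxy : G.Adj x y)
    (hy2 : G.Adj y v₂) : ∃ c : V → Fin 3, (∀ a b, G.Adj a b → c a ≠ c b) ∧ c v₁ ≠ c v₃ := by
  set N : Set V := {v₀, v₂, x, y} with hN
  obtain ⟨h1, h3⟩ := h.notMem_path hG h0x hxy hy2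
  let Y : Set V := {u | u ∉ N ∧ (within G Nᶜ).Reachable v₃ u}
  have h3Y : v₃ ∈ Y := ⟨h3, SimpleGraph.Reachable.refl _⟩
  have h1Y : v₁ ∉ Y := fun hY => hφ.not_crossing h h1 h3 (by simp) (by simp)
    (reachable_of_three_path h0x hxy hy2 (by simp) (by simp) (by simp)
      (by simp)) hY.2.symm
  have hYN : ∀ u ∈ Y, ∀ w, w ∉ Y → G.Adj u w → w ∈ N := by
    intro u hu w hw huw
    by_contra hwN
    refine hw ⟨hwN, hu.2.trans (SimpleGraph.Adj.reachable ?_)⟩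
    exact ⟨huw, hu.1, hwN⟩
  obtain ⟨c₁, hc₁, k₁, hk₁⟩ := exists_coloring_avoiding ⟨F, φ, hφ⟩ hG
    (N := {x, v₀, v₁, v₂}) card_le_four
  obtain ⟨c₂, hc₂, k₂, hk₂⟩ := exists_coloring_avoiding ⟨F, φ, hφ⟩ hG
    (N := {y, v₀, v₃, v₂}) card_le_four
  simp only [mem_insert, mem_singleton, forall_eq_or_imp, forall_eq] at hk₁ hk₂
  obtain ⟨hx₁, h0₁, h1₁, h2₁⟩ := hk₁
  obtain ⟨hy₂, h0₂, h3₂, h2₂⟩ := hk₂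
  have e1 : c₁ v₀ = c₁ v₂ :=
    fin_three_eq _ _ _ _ (hc₁ _ _ h.adj₀₁) (hc₁ _ _ h.adj₁₂.symm) h0₁ h2₁ h1₁
  have e2 : c₁ y = k₁ := fin_three_eq _ _ _ _ (hc₁ _ _ hxy.symm) hx₁.symm
    (hc₁ _ _ hy2) h2₁.symm (e1 ▸ (hc₁ _ _ h0x).symm)
  have e3 : c₂ v₀ = c₂ v₂ :=
    fin_three_eq _ _ _ _ (hc₂ _ _ h.adj₃₀.symm) (hc₂ _ _ h.adj₂₃) h0₂ h2₂ h3₂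
  have e4 : c₂ x = k₂ := fin_three_eq _ _ _ _ (hc₂ _ _ hxy) hy₂.symm
    (hc₂ _ _ h0x.symm) h0₂.symm (e3 ▸ hc₂ _ _ hy2)
  have e5 : c₂ v₃ = c₂ y := fin_three_eq _ _ _ _ (hc₂ _ _ h.adj₂₃.symm) (hc₂ _ _ hy2) h3₂ hy₂ h2₂
  obtain ⟨π, hπ, hπ0, hπy, hπx⟩ := exists_injective_fin_three (a := c₂ v₀) (b := c₂ y) (c := k₂)
    (a' := c₁ v₀) (b' := k₁) (c' := c₁ x) (e3 ▸ (hc₂ _ _ hy2).symm) h0₂ hy₂ h0₁ (hc₁ _ _ h0x)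
    hx₁.symm
  have hagree : ∀ w ∈ N, c₁ w = π (c₂ w) := by
    simp only [hN, Set.mem_insert_iff, Set.mem_singleton_iff, forall_eq_or_imp, forall_eq]
    exact ⟨hπ0.symm, by rw [← e1, ← e3, hπ0], by rw [e4, hπx], by rw [e2, hπy]⟩
  refine ⟨fun v => if v ∈ Y then π (c₂ v) else c₁ v, fun a b hab => ?_, ?_⟩
  · by_cases ha : a ∈ Y <;> by_cases hb : b ∈ Y <;> simp only [ha, hb, if_true, if_false]
    · exact hπ.ne (hc₂ _ _ hab)
    · rw [hagree b (hYN a ha b hb hab)]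
      exact hπ.ne (hc₂ _ _ hab)
    · rw [hagree a (hYN b hb a ha hab.symm)]
      exact hπ.ne (hc₂ _ _ hab)
    · exact hc₁ _ _ hab
  · simp only [h3Y, h1Y, if_true, if_false]
    rwa [e5, hπy]

/-- The Aksenov / Jensen–Thomassen theorem for graphs with an algebraic dual. -/
theorem exists_coloring_ne_of_hasDual [Fintype V] {G : SimpleGraph V} (hdual : HasDual G)
    (hG : TriFree G) {a b : V} (hne : a ≠ b) :
    ∃ c : V → Fin 3, (∀ u v, G.Adj u v → c u ≠ c v) ∧ c a ≠ c b := by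
  induction hm : #(darts G univ) using Nat.strong_induction_on generalizing G a b with
  | _ m ih =>
  subst hm
  by_contra hno
  have hH : ∀ u v, (G ⊔ SimpleGraph.edge a b).Adj u v → G.Adj u v ∨ (u, v) = (a, b) ∨
      (u, v) = (b, a) := by
    intro u v huv
    rw [SimpleGraph.sup_adj, SimpleGraph.edge_adj] at huv
    simp only [Prod.mk.injEq]
    tauto
  have hnc : ¬ ColOn (G ⊔ SimpleGraph.edge a b) univ := by
    rintro ⟨c, hc⟩
    exact hno ⟨c, fun u v huv => hc _ (mem_univ _) _ (mem_univ _) (Or.inl huv),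
      hc a (mem_univ _) b (mem_univ _) (Or.inr (by simp [SimpleGraph.edge_adj, hne]))⟩
  obtain ⟨R, -, hR, hpot⟩ := kostochka_yancey _ _ hnc
  have hR4 := four_le_card_of_not_colOn hR
  have hin : ∀ u v, G.Adj u v → u ∈ R := by
    by_contra! hout
    obtain ⟨u, v, huv, hu⟩ := hout
    obtain ⟨c, hc, hk⟩ := ih _ (darts_lt (within_le G R) huv fun h => hu h.2.1)
      (hdual.mono (within_le G R)) (hG.mono (within_le G R)) hne rfl
    refine hR ⟨c, fun p hp q hq hpq => ?_⟩
    rcases hH p q hpq with h | h | h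
    · exact hc _ _ ⟨h, hp, hq⟩
    · obtain ⟨rfl, rfl⟩ := Prod.mk.inj h
      exact hk
    · obtain ⟨rfl, rfl⟩ := Prod.mk.inj h
      exact hk.symm
  obtain ⟨F, φ, hφ⟩ := hdual
  by_cases h4 : ∀ f v₀ v₁ v₂ v₃, ¬ FourFace G φ f v₀ v₁ v₂ v₃
  · have heul := hφ.euler hG h4 (R := R) (card_pos.1 (by omega)) hin
    have hsub : darts (G ⊔ SimpleGraph.edge a b) R ⊆ darts G univ ∪ {(a, b), (b, a)} := by
      rintro ⟨u, v⟩ huv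
      rcases hH u v (mem_darts.1 huv).2.2 with h | h | h
      · exact mem_union_left _ (mem_darts.2 ⟨mem_univ _, mem_univ _, h⟩)
      · simp [h]
      · simp [h]
    have hle := (card_le_card hsub).trans ((card_union_le _ _).trans
      (Nat.add_le_add_left card_le_two _))
    unfold pot at hpot
    omega
  · push Not at h4
    obtain ⟨f, h4⟩ := h4
    obtain ⟨v₀, v₁, v₂, v₃, h, hab⟩ : ∃ v₀ v₁ v₂ v₃, FourFace G φ f v₀ v₁ v₂ v₃ ∧
        s(a, b) ≠ s(v₀, v₂) := by
      obtain ⟨v₀, v₁, v₂, v₃, h⟩ := h4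
      by_cases hab : s(a, b) = s(v₀, v₂)
      · refine ⟨v₁, v₂, v₃, v₀, h.rotate, ?_⟩
        rw [hab]
        simp [h.adj₀₁.ne, h.adj₃₀.ne']
      · exact ⟨v₀, v₁, v₂, v₃, h, hab⟩
    have path : ∀ {w₀ w₁ w₂ w₃}, FourFace G φ f w₀ w₁ w₂ w₃ → s(a, b) ≠ s(w₀, w₂) →
        ∃ p q, G.Adj w₀ p ∧ G.Adj p q ∧ G.Adj q w₂ := by
      intro w₀ w₁ w₂ w₃ hw habw
      by_contra! hp
      have h02 := hw.not_adj₀₂ hG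
      have hne' : glueMap w₀ w₂ a ≠ glueMap w₀ w₂ b := by
        intro he
        rcases glueMap_eq he with h1 | ⟨h1, h1'⟩
        · rcases glueMap_eq h1.symm with h2 | ⟨h2, h2'⟩
          · exact hne h2.symm
          · exact habw (by rw [h2, h2'])
        · rcases glueMap_eq h1' with h2 | ⟨h2, h2'⟩
          · exact habw (by rw [h1, h2, Sym2.eq_swap])
          · exact hne (h1.trans h2.symm)
      obtain ⟨c, hc, hk⟩ := ih _ (darts_glue_lt hw.ne₀₂ hw.adj₀₁ hw.adj₁₂.symm)
        (hφ.hasDual_glue hw h02) (hG.triFree_glue hp) hne' rfl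
      exact hno ⟨fun v => c (glueMap w₀ w₂ v), fun a b hab => hc _ _ (glue_adj_map h02 hab), hk⟩
    obtain ⟨x, y, h0x, hxy, hy2⟩ := path h hab
    by_cases hab' : s(a, b) = s(v₁, v₃)
    · obtain ⟨c, hc, hk⟩ := hφ.exists_coloring_opposite_ne hG h h0x hxy hy2
      refine hno ⟨c, hc, ?_⟩
      rcases Sym2.eq_iff.1 hab' with ⟨rfl, rfl⟩ | ⟨rfl, rfl⟩
      · exact hk
      · exact hk.symm
    · obtain ⟨r, s, h1r, hrs, hs3⟩ := path h.rotate hab'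
      exact hφ.not_two_paths hG h h0x hxy hy2 h1r hrs hs3

end Main

section Grid

open Finset Classical

/-- The 4-neighbor graph on the integer lattice. -/
def lattice : SimpleGraph (ℤ × ℤ) where
  Adj p q := (p.2 = q.2 ∧ (q.1 = p.1 + 1 ∨ p.1 = q.1 + 1)) ∨
    (p.1 = q.1 ∧ (q.2 = p.2 + 1 ∨ p.2 = q.2 + 1))
  symm := ⟨fun p q h => by omega⟩
  loopless := ⟨fun p h => by omega⟩

/-- The lattice points with both coordinates at most `n` in absolute value. -/
noncomputable def box (n : ℤ) : Finset (ℤ × ℤ) := Icc (-n) n ×ˢ Icc (-n) n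

lemma mem_box {n : ℤ} {p : ℤ × ℤ} :
    p ∈ box n ↔ (-n ≤ p.1 ∧ p.1 ≤ n) ∧ (-n ≤ p.2 ∧ p.2 ≤ n) := by
  simp [box]

/-- The 4-neighbor graph on a box. -/
def grid (n : ℤ) : SimpleGraph (box n) := lattice.comap Subtype.val

lemma eq_zero_of_eq_pred {f : ℤ → ZMod 2} (h : ∀ j, f j = f (j - 1)) {m : ℤ}
    (h0 : ∀ j < m, f j = 0) (j : ℤ) : f j = 0 := by
  by_cases hj : j < m
  · exact h0 j hj
  · have hj' : m - 1 ≤ j := by omega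
    induction j, hj' using Int.leInduction with
    | base => exact h0 _ (by omega)
    | succ k hk ih =>
      rw [h, add_sub_cancel_right]
      by_cases hk' : k < m
      · exact h0 k hk'
      · exact ih hk'

lemma exists_pred_sum (f : ℤ → ZMod 2) {m : ℤ} (h0 : ∀ j < m, f j = 0) :
    ∃ S : ℤ → ZMod 2, (∀ j, f j = S j + S (j - 1)) ∧ ∀ j < m, S j = 0 := by
  refine ⟨fun j => ∑ k ∈ Icc m j, f k, fun j => ?_, fun j hj => ?_⟩ <;> beta_reduce
  · by_cases hj : j < m
    · rw [h0 j hj, Icc_eq_empty (by omega), Icc_eq_empty (by omega)]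
      simp
    · have : Icc m j = insert j (Icc m (j - 1)) := by
        ext k
        simp only [mem_Icc, mem_insert]
        omega
      rw [this, sum_insert (by simp), add_assoc, CharTwo.add_self_eq_zero, add_zero]
  · rw [Icc_eq_empty (by omega), sum_empty]

/-- The discrete Poincaré lemma modulo 2 for finitely supported cycles on the lattice. -/
lemma exists_lattice_potential {n : ℤ} {h v : ℤ → ℤ → ZMod 2}
    (hh : ∀ i j, ¬ ((-n ≤ i ∧ i + 1 ≤ n) ∧ -n ≤ j ∧ j ≤ n) → h i j = 0)
    (hv : ∀ i j, ¬ ((-n ≤ i ∧ i ≤ n) ∧ -n ≤ j ∧ j + 1 ≤ n) → v i j = 0)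
    (hz : ∀ i j, h i j + h (i - 1) j + v i j + v i (j - 1) = 0) :
    ∃ S : ℤ → ℤ → ZMod 2, (∀ i j, h i j = S i j + S i (j - 1)) ∧
      (∀ i j, v i j = S i j + S (i - 1) j) ∧
      ∀ i j, ¬ ((-n ≤ i ∧ i + 1 ≤ n) ∧ -n ≤ j ∧ j + 1 ≤ n) → S i j = 0 := by
  choose S hS hS0 using fun i => exists_pred_sum (h i) (m := -n) fun j hj => hh i j (by omega)
  have hvS : ∀ i j, v i j = S i j + S (i - 1) j := by
    intro i j
    rw [← CharTwo.add_eq_zero]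
    refine eq_zero_of_eq_pred (f := fun j => v i j + (S i j + S (i - 1) j)) (m := -n)
      (fun j => ?_) (fun j hj => ?_) j
    · have h1 := hz i j
      rw [hS, hS] at h1
      rw [← CharTwo.add_eq_zero, ← h1]
      ring
    · simp only [hv i j (by omega), hS0 i j hj, hS0 (i - 1) j hj, add_zero]
  refine ⟨S, hS, hvS, fun i j hij => ?_⟩
  have hleft : ∀ i j, i < -n → S i j = 0 := fun i j hi =>
    eq_zero_of_eq_pred (m := -n) (fun j => by
      rw [← CharTwo.add_eq_zero, ← hS, hh i j (by omega)]) (hS0 i) j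
  by_cases hi : -n ≤ i ∧ i + 1 ≤ n
  · by_cases hj : j < -n
    · exact hS0 i j hj
    · exact eq_zero_of_eq_pred (f := fun i => S i j) (m := -n) (fun i => by
        rw [← CharTwo.add_eq_zero, ← hvS, hv i j (by omega)]) (fun i hi => hleft i j hi) i
  · exact eq_zero_of_eq_pred (m := -n) (fun j => by
      rw [← CharTwo.add_eq_zero, ← hS, hh i j (by omega)]) (hS0 i) j

/-- The unit cell to the left of a lattice edge, a cell being named by its lower left corner. -/
def leftCell (p q : ℤ × ℤ) : ℤ × ℤ :=
  if q.1 = p.1 + 1 then p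
  else if p.1 = q.1 + 1 then (q.1, q.2 - 1)
  else if q.2 = p.2 + 1 then (p.1 - 1, p.2)
  else q

lemma leftCell_right (i j : ℤ) : leftCell (i, j) (i + 1, j) = (i, j) := by
  simp [leftCell]

lemma leftCell_left (i j : ℤ) : leftCell (i + 1, j) (i, j) = (i, j - 1) := by
  rw [leftCell, if_neg (by simp only; omega), if_pos rfl]

lemma leftCell_up (i j : ℤ) : leftCell (i, j) (i, j + 1) = (i - 1, j) := by
  simp [leftCell]

lemma leftCell_down (i j : ℤ) : leftCell (i, j + 1) (i, j) = (i, j) := by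
  rw [leftCell, if_neg (by simp), if_neg (by simp), if_neg (by simp only; omega)]

/-- The face of the grid containing a cell: all cells outside the box are identified. -/
def gridFace (n : ℤ) (c : ℤ × ℤ) : Option (ℤ × ℤ) :=
  if (-n ≤ c.1 ∧ c.1 + 1 ≤ n) ∧ -n ≤ c.2 ∧ c.2 + 1 ≤ n then some c else none

/-- A function on the darts of the grid, extended by zero to the lattice. -/
noncomputable def extend {n : ℤ} (z : box n → box n → ZMod 2) (p q : ℤ × ℤ) : ZMod 2 :=
  if h : p ∈ box n ∧ q ∈ box n then z ⟨p, h.1⟩ ⟨q, h.2⟩ else 0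

lemma extend_zero {n : ℤ} {z : box n → box n → ZMod 2} {p q : ℤ × ℤ}
    (h : ¬ (p ∈ box n ∧ q ∈ box n)) : extend z p q = 0 := dif_neg h

lemma extend_comm {n : ℤ} {z : box n → box n → ZMod 2} (hz : EdgeChain (grid n) z) (p q : ℤ × ℤ) :
    extend z p q = extend z q p := by
  by_cases h : p ∈ box n ∧ q ∈ box n
  · rw [extend, extend, dif_pos h, dif_pos h.symm, hz.symm]
  · rw [extend_zero h, extend_zero fun h' => h h'.symm]

lemma extend_coe {n : ℤ} {z : box n → box n → ZMod 2} (a b : box n) :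
    extend z a b = z a b := dif_pos ⟨a.2, b.2⟩

lemma sum_grid {n : ℤ} {z : box n → box n → ZMod 2} (hz : EdgeChain (grid n) z) (a : box n) :
    ∑ b, z a b = extend z a (a.1.1 + 1, a.1.2) + extend z (a.1.1 - 1, a.1.2) a +
      extend z a (a.1.1, a.1.2 + 1) + extend z (a.1.1, a.1.2 - 1) a := by
  obtain ⟨⟨i, j⟩, ha⟩ := a
  have hsupp : ∀ q, q ∉ ({(i + 1, j), (i - 1, j), (i, j + 1), (i, j - 1)} : Finset (ℤ × ℤ)) →
      extend z (i, j) q = 0 := by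
    rintro ⟨k, l⟩ hq
    by_cases hqb : (k, l) ∈ box n
    · rw [extend, dif_pos ⟨ha, hqb⟩]
      refine hz.zero _ _ fun hadj => hq ?_
      change lattice.Adj (i, j) (k, l) at hadj
      simp only [lattice] at hadj
      simp only [mem_insert, mem_singleton, Prod.mk.injEq]
      omega
    · exact extend_zero fun h => hqb h.2
  calc ∑ b, z ⟨(i, j), ha⟩ b = ∑ b : box n, extend z (i, j) b :=
        sum_congr rfl fun b _ => (extend_coe ⟨(i, j), ha⟩ b).symm
    _ = ∑ q ∈ box n, extend z (i, j) q := sum_coe_sort (box n) _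
    _ = ∑ q ∈ box n ∪ {(i + 1, j), (i - 1, j), (i, j + 1), (i, j - 1)}, extend z (i, j) q :=
        sum_subset subset_union_left fun q _ hq => extend_zero fun h => hq h.2
    _ = ∑ q ∈ {(i + 1, j), (i - 1, j), (i, j + 1), (i, j - 1)}, extend z (i, j) q :=
        (sum_subset subset_union_right fun q _ hq => hsupp q hq).symm
    _ = _ := by
      rw [sum_insert, sum_insert, sum_insert, sum_singleton, extend_comm hz (i - 1, j),
        extend_comm hz (i, j - 1)]
      · ring
      all_goals
        simp only [mem_insert, mem_singleton, Prod.mk.injEq]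
        omega

/-- A function on grid faces induces the expected chain exactly when its values do so on the
horizontal and on the vertical lattice edges. -/
lemma grid_coboundary_iff {n : ℤ} {z : box n → box n → ZMod 2} (hz : EdgeChain (grid n) z)
    (T : Option (ℤ × ℤ) → ZMod 2) :
    (∀ a b, (grid n).Adj a b →
      z a b = T (gridFace n (leftCell a b)) + T (gridFace n (leftCell b a))) ↔
    (∀ i j, extend z (i, j) (i + 1, j) =
      T (gridFace n (i, j)) + T (gridFace n (i, j - 1))) ∧
    ∀ i j, extend z (i, j) (i, j + 1) =
      T (gridFace n (i, j)) + T (gridFace n (i - 1, j)) := by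
  constructor
  · intro h
    constructor <;> intro i j
    · by_cases hb : (i, j) ∈ box n ∧ (i + 1, j) ∈ box n
      · rw [extend, dif_pos hb, h _ _ (by simp [grid, lattice])]
        simp only [leftCell_right, leftCell_left]
      · rw [extend_zero hb, gridFace, if_neg, gridFace, if_neg, CharTwo.add_self_eq_zero]
        all_goals
          simp only [mem_box] at hb ⊢
          omega
    · by_cases hb : (i, j) ∈ box n ∧ (i, j + 1) ∈ box n
      · rw [extend, dif_pos hb, h _ _ (by simp [grid, lattice])]
        simp only [leftCell_up, leftCell_down, add_comm]
      · rw [extend_zero hb, gridFace, if_neg, gridFace, if_neg, CharTwo.add_self_eq_zero]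
        all_goals
          simp only [mem_box] at hb ⊢
          omega
  · rintro ⟨hh, hv⟩ a b hab
    rw [← extend_coe (z := z)]
    obtain ⟨⟨i, j⟩, ha⟩ := a
    obtain ⟨⟨k, l⟩, hb⟩ := b
    change lattice.Adj (i, j) (k, l) at hab
    simp only [lattice] at hab
    rcases hab with ⟨rfl, rfl | rfl⟩ | ⟨rfl, rfl | rfl⟩
    · rw [leftCell_right, leftCell_left, hh]
    · rw [leftCell_right, leftCell_left, extend_comm hz, hh, add_comm]
    · rw [leftCell_up, leftCell_down, hv, add_comm]
    · rw [leftCell_up, leftCell_down, extend_comm hz, hv]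

lemma hasDual_grid (n : ℤ) : HasDual (grid n) := by
  refine ⟨Option (ℤ × ℤ), fun a b => gridFace n (leftCell a b), fun z hz => ?_⟩
  simp only [grid_coboundary_iff hz]
  constructor
  · intro h
    obtain ⟨S, hh, hv, h0⟩ := exists_lattice_potential (n := n)
      (h := fun i j => extend z (i, j) (i + 1, j)) (v := fun i j => extend z (i, j) (i, j + 1))
      (fun i j hij => extend_zero fun hb => hij (by simp only [mem_box] at hb; omega))
      (fun i j hij => extend_zero fun hb => hij (by simp only [mem_box] at hb; omega))
      (fun i j => by
        simp only [sub_add_cancel]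
        by_cases hb : (i, j) ∈ box n
        · rw [← sum_grid hz ⟨(i, j), hb⟩, h]
        · rw [extend_zero fun h => hb h.1, extend_zero fun h => hb h.2,
            extend_zero fun h => hb h.1, extend_zero fun h => hb h.2]
          simp)
    have hT : ∀ i j, Option.elim (gridFace n (i, j)) 0 (fun c => S c.1 c.2) = S i j := by
      intro i j
      rw [gridFace]
      split_ifs with hij
      · rfl
      · exact (h0 i j hij).symm
    exact ⟨fun f => f.elim 0 fun c => S c.1 c.2, fun i j => by beta_reduce; rw [hh, hT, hT],
      fun i j => by beta_reduce; rw [hv, hT, hT]⟩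
  · rintro ⟨T, hh, hv⟩ a
    obtain ⟨⟨i, j⟩, ha⟩ := a
    have h1 := hh (i - 1) j
    have h2 := hv i (j - 1)
    rw [sub_add_cancel] at h1 h2
    rw [sum_grid hz, hh, hv, h1, h2]
    generalize T (gridFace n (i, j)) = x
    generalize T (gridFace n (i - 1, j)) = y
    generalize T (gridFace n (i, j - 1)) = w
    generalize T (gridFace n (i - 1, j - 1)) = t
    revert x y w t
    decide

end Grid

section LatticeModel

lemma within_reachable_mono {X : Type*} {G : SimpleGraph X} {s t : Set X} (h : s ⊆ t) {p q : X}
    (hpq : (within G s).Reachable p q) : (within G t).Reachable p q :=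
  hpq.mono (G := within G s) fun _ _ hab => ⟨hab.1, h hab.2.1, h hab.2.2⟩

lemma mem_of_within_reachable {X : Type*} {G : SimpleGraph X} {s : Set X} {p q : X}
    (hpq : (within G s).Reachable p q) (hp : p ∈ s) : q ∈ s := by
  obtain ⟨w⟩ := hpq
  induction w with
  | nil => exact hp
  | cons h _ ih => exact ih h.2.2

lemma within_reachable_of_component {X : Type*} {G : SimpleGraph X} {s : Set X} {o p q : X}
    (hop : (within G s).Reachable o p) (hpq : (within G s).Reachable p q) :
    (within G {r | (within G s).Reachable o r}).Reachable p q := by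
  obtain ⟨w⟩ := hpq
  induction w with
  | nil => exact SimpleGraph.Reachable.refl _
  | cons h _ ih =>
    have h' := hop.trans h.reachable
    exact SimpleGraph.Reachable.trans (SimpleGraph.Adj.reachable ⟨h.1, hop, h'⟩) (ih h')

lemma within_comap_reachable {X : Type*} {G : SimpleGraph X} {t : Finset X} {s : Set X}
    (hst : s ⊆ t) {p q : X} (hpq : (within G s).Reachable p q) (hp : p ∈ t) (hq : q ∈ t) :
    (within (G.comap (Subtype.val : t → X)) (Subtype.val ⁻¹' s)).Reachable ⟨p, hp⟩ ⟨q, hq⟩ := by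
  obtain ⟨w⟩ := hpq
  induction w with
  | nil => exact SimpleGraph.Reachable.refl _
  | cons h _ ih =>
    have h' : (within (G.comap (Subtype.val : t → X)) (Subtype.val ⁻¹' s)).Adj
        ⟨_, hp⟩ ⟨_, hst h.2.2⟩ := ⟨h.1, h.2⟩
    exact h'.reachable.trans (ih (hst h.2.2) hq)

lemma exists_adj_of_within_reachable {X : Type*} {G : SimpleGraph X} {e s t : Set X} {o p q : X}
    (hes : e \ t ⊆ s) (hdisj : Disjoint s t) (ho : o ∈ s) (hpq : (within G e).Reachable p q)
    (hp : (within G s).Reachable o p) (hq : q ∈ t) :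
    ∃ a, (within G s).Reachable o a ∧ ∃ b ∈ t, G.Adj a b := by
  obtain ⟨w⟩ := hpq
  induction w with
  | nil => exact absurd hq (Set.disjoint_left.1 hdisj (mem_of_within_reachable hp ho))
  | @cons p r q h _ ih =>
    by_cases hr : r ∈ t
    · exact ⟨p, hp, r, hr, h.1⟩
    · exact ih (hp.trans (SimpleGraph.Adj.reachable
        ⟨h.1, mem_of_within_reachable hp ho, hes ⟨h.2.2, hr⟩⟩)) hq

/-- A graph modelled by connected sets of lattice points, one for each vertex and one for each
edge, with intersections only at incidences, has an algebraic dual. -/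
lemma hasDual_of_lattice_model [Fintype V] [LinearOrder V] {G : SimpleGraph V} {n : ℤ}
    (hn : 0 ≤ n) {A : V → Set (ℤ × ℤ)} {E : V → V → Set (ℤ × ℤ)}
    (hAbox : ∀ v, A v ⊆ box n) (hEbox : ∀ u v, E u v ⊆ box n) (hA : ∀ v, (A v).Nonempty)
    (hAconn : ∀ v, ∀ p ∈ A v, ∀ q ∈ A v, (within lattice (A v)).Reachable p q)
    (hEconn : ∀ u v, ∀ p ∈ E u v, ∀ q ∈ E u v, (within lattice (E u v)).Reachable p q)
    (hAA : ∀ u v, u ≠ v → Disjoint (A u) (A v))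
    (hEA : ∀ u v w, u < v → w ≠ u → w ≠ v → Disjoint (E u v) (A w))
    (hEE : ∀ u v u' v', u < v → u' < v' → u ≠ u' → Disjoint (E u v) (E u' v'))
    (hinc : ∀ u v, u < v → G.Adj u v → (E u v ∩ A u).Nonempty ∧ (E u v ∩ A v).Nonempty) :
    HasDual G := by
  choose o ho using hA
  let C : V → Set (ℤ × ℤ) := fun u => A u ∪ {p | ∃ v, u < v ∧ p ∈ E u v ∧ p ∉ A v}
  let B : V → Set (ℤ × ℤ) := fun u => {p | (within lattice (C u)).Reachable (o u) p}
  have hAC : ∀ u, A u ⊆ C u := fun u => Set.subset_union_left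
  have hBC : ∀ u, B u ⊆ C u := fun u p hp => mem_of_within_reachable hp (hAC u (ho u))
  have hAB : ∀ u, A u ⊆ B u := fun u p hp =>
    within_reachable_mono (hAC u) (hAconn u _ (ho u) _ hp)
  have hCbox : ∀ u, C u ⊆ box n := by
    rintro u p (hp | ⟨v, -, hp, -⟩)
    · exact hAbox u hp
    · exact hEbox u v hp
  have hCA : ∀ u v, u ≠ v → Disjoint (C u) (A v) := by
    intro u v huv
    rw [Set.disjoint_left]
    rintro p (hp | ⟨w, huw, hp, hpw⟩) hpv
    · exact Set.disjoint_left.1 (hAA u v huv) hp hpv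
    · by_cases hwv : v = w
      · exact hpw (hwv ▸ hpv)
      · exact Set.disjoint_left.1 (hEA u w v huw huv.symm hwv) hp hpv
  have hCC : ∀ u v, u ≠ v → Disjoint (C u) (C v) := by
    intro u v huv
    rw [Set.disjoint_left]
    rintro p hpu hpv
    rcases id hpu with hpu' | ⟨w, huw, hpw, -⟩
    · exact Set.disjoint_left.1 (hCA v u huv.symm) hpv hpu'
    · rcases hpv with hpv' | ⟨w', hvw', hpw', -⟩
      · exact Set.disjoint_left.1 (hCA u v huv) hpu hpv'
      · exact Set.disjoint_left.1 (hEE u w v w' huw hvw' huv) hpw hpw'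
  have hedge : ∀ u v, u < v → G.Adj u v → ∃ a ∈ B u, ∃ b ∈ B v, lattice.Adj a b := by
    intro u v huv hadj
    obtain ⟨⟨p, hpE, hpA⟩, q, hqE, hqA⟩ := hinc u v huv hadj
    obtain ⟨a, ha, b, hb, hab⟩ := exists_adj_of_within_reachable
      (fun r hr => Or.inr ⟨v, huv, hr.1, hr.2⟩) (hCA u v huv.ne) (hAC u (ho u))
      (hEconn u v p hpE q hqE) (hAB u hpA) hqA
    exact ⟨a, ha, b, hAB v hb, hab⟩
  have hedge' : ∀ u v, G.Adj u v → ∃ a ∈ B u, ∃ b ∈ B v, lattice.Adj a b := by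
    intro u v hadj
    rcases lt_trichotomy u v with h | h | h
    · exact hedge u v h hadj
    · exact absurd h hadj.ne
    · obtain ⟨a, ha, b, hb, hab⟩ := hedge v u h hadj.symm
      exact ⟨b, hb, a, ha, hab.symm⟩
  have : Nonempty (box n) := ⟨⟨(0, 0), mem_box.2 (by simpa using hn)⟩⟩
  refine (hasDual_grid n).minor (fun v => Subtype.val ⁻¹' B v) ?_ ?_ ?_
  · intro u v a hu hv
    by_contra huv
    exact Set.disjoint_left.1 (hCC u v huv) (hBC u hu) (hBC v hv)
  · rintro v ⟨a, ha'⟩ ha ⟨b, hb'⟩ hb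
    exact within_comap_reachable ((hBC v).trans (hCbox v))
      (within_reachable_of_component ha ((SimpleGraph.Reachable.symm ha).trans hb)) ha' hb'
  · intro u v huv
    obtain ⟨a, ha, b, hb, hab⟩ := hedge' u v huv
    exact ⟨⟨a, hCbox u (hBC u ha)⟩, ha, ⟨b, hCbox v (hBC v hb)⟩, hb, hab⟩

end LatticeModel

section Discretization

open Filter Topology

/-- The lattice points `p` such that `δ p` is at distance at most `δ` from `x`. -/
def nearby (δ : ℝ) (x : ℝ × ℝ) : Set (ℤ × ℤ) := {p | |x.1 - δ * p.1| ≤ δ ∧ |x.2 - δ * p.2| ≤ δ}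

/-- The lattice points near a set. -/
def discretize (δ : ℝ) (K : Set (ℝ × ℝ)) : Set (ℤ × ℤ) := ⋃ x ∈ K, nearby δ x

lemma nearby_subset_discretize {δ : ℝ} {K : Set (ℝ × ℝ)} {x : ℝ × ℝ} (hx : x ∈ K) :
    nearby δ x ⊆ discretize δ K := Set.subset_biUnion_of_mem hx

lemma exists_mem_nearby {δ : ℝ} (hδ : 0 < δ) (x : ℝ × ℝ) :
    ∃ p ∈ nearby δ x, ∀ y, dist y x < δ / 2 → p ∈ nearby δ y := by
  have key : ∀ s : ℝ, |s - δ * round (s / δ)| ≤ δ / 2 := by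
    intro s
    have h := abs_sub_round (s / δ)
    have : s - δ * round (s / δ) = δ * (s / δ - round (s / δ)) := by
      field_simp
    rw [this, abs_mul, abs_of_pos hδ]
    nlinarith
  refine ⟨(round (x.1 / δ), round (x.2 / δ)), ⟨(key _).trans (by linarith),
    (key _).trans (by linarith)⟩, fun y hy => ?_⟩
  rw [Prod.dist_eq, max_lt_iff, Real.dist_eq, Real.dist_eq] at hy
  constructor
  · have := abs_sub_le y.1 x.1 (δ * round (x.1 / δ))
    linarith [key x.1, hy.1]
  · have := abs_sub_le y.2 x.2 (δ * round (x.2 / δ))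
    linarith [key x.2, hy.2]

lemma lattice_reachable_horizontal {s : Set (ℤ × ℤ)} {a b j : ℤ} (hab : a ≤ b)
    (h : ∀ k, a ≤ k → k ≤ b → (k, j) ∈ s) : (within lattice s).Reachable (a, j) (b, j) := by
  induction b, hab using Int.leInduction with
  | base => exact SimpleGraph.Reachable.refl _
  | succ b hab ih =>
    refine (ih fun k h1 h2 => h k h1 (by omega)).trans (SimpleGraph.Adj.reachable ⟨?_, ?_, ?_⟩)
    · simp [lattice]
    · exact h b hab (by omega)
    · exact h (b + 1) (by omega) le_rfl

lemma lattice_reachable_vertical {s : Set (ℤ × ℤ)} {a b i : ℤ} (hab : a ≤ b)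
    (h : ∀ k, a ≤ k → k ≤ b → (i, k) ∈ s) : (within lattice s).Reachable (i, a) (i, b) := by
  induction b, hab using Int.leInduction with
  | base => exact SimpleGraph.Reachable.refl _
  | succ b hab ih =>
    refine (ih fun k h1 h2 => h k h1 (by omega)).trans (SimpleGraph.Adj.reachable ⟨?_, ?_, ?_⟩)
    · simp [lattice]
    · exact h b hab (by omega)
    · exact h (b + 1) (by omega) le_rfl

lemma abs_sub_mul_le_of_between {δ s : ℝ} (hδ : 0 < δ) {a b k : ℤ} (ha : |s - δ * a| ≤ δ)
    (hb : |s - δ * b| ≤ δ) (hak : a ≤ k) (hkb : k ≤ b) : |s - δ * k| ≤ δ := by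
  rw [abs_le] at *
  have h1 : δ * a ≤ δ * k := mul_le_mul_of_nonneg_left (by exact_mod_cast hak) hδ.le
  have h2 : δ * k ≤ δ * b := mul_le_mul_of_nonneg_left (by exact_mod_cast hkb) hδ.le
  constructor <;> linarith

lemma nearby_reachable {δ : ℝ} (hδ : 0 < δ) (x : ℝ × ℝ) {p q : ℤ × ℤ} (hp : p ∈ nearby δ x)
    (hq : q ∈ nearby δ x) : (within lattice (nearby δ x)).Reachable p q := by
  obtain ⟨a, b⟩ := p
  obtain ⟨c, d⟩ := q
  have h1 : (within lattice (nearby δ x)).Reachable (a, b) (c, b) := by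
    rcases le_total a c with h | h
    · exact lattice_reachable_horizontal h fun k hk hk' =>
        ⟨abs_sub_mul_le_of_between hδ hp.1 hq.1 hk hk', hp.2⟩
    · exact (lattice_reachable_horizontal (s := nearby δ x) h fun k hk hk' =>
        ⟨abs_sub_mul_le_of_between hδ hq.1 hp.1 hk hk', hp.2⟩).symm
  have h2 : (within lattice (nearby δ x)).Reachable (c, b) (c, d) := by
    rcases le_total b d with h | h
    · exact lattice_reachable_vertical h fun k hk hk' =>
        ⟨hq.1, abs_sub_mul_le_of_between hδ hp.2 hq.2 hk hk'⟩
    · exact (lattice_reachable_vertical (s := nearby δ x) h fun k hk hk' =>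
        ⟨hq.1, abs_sub_mul_le_of_between hδ hq.2 hp.2 hk hk'⟩).symm
  exact h1.trans h2

lemma discretize_reachable {δ : ℝ} (hδ : 0 < δ) {K : Set (ℝ × ℝ)} (hK : IsPreconnected K)
    {p q : ℤ × ℤ} (hp : p ∈ discretize δ K) (hq : q ∈ discretize δ K) :
    (within lattice (discretize δ K)).Reachable p q := by
  simp only [discretize, Set.mem_iUnion, exists_prop] at hp hq
  obtain ⟨x, hx, hp⟩ := hp
  obtain ⟨y, hy, hq⟩ := hq
  refine hK.induction₂ (fun x y => ∀ p ∈ nearby δ x, ∀ q ∈ nearby δ y,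
    (within lattice (discretize δ K)).Reachable p q) ?_ ?_ ?_ hx hy p hp q hq
  · intro x hx
    obtain ⟨r, hr, hr'⟩ := exists_mem_nearby hδ x
    filter_upwards [self_mem_nhdsWithin, mem_nhdsWithin_of_mem_nhds
      (Metric.ball_mem_nhds x (half_pos hδ))] with y hyK hy p hp q hq
    exact (within_reachable_mono (nearby_subset_discretize hx) (nearby_reachable hδ x hp hr)).trans
      (within_reachable_mono (nearby_subset_discretize hyK) (nearby_reachable hδ y (hr' y hy) hq))
  · intro x y z _ _ _ hxy hyz p hp q hq
    obtain ⟨r, hr, -⟩ := exists_mem_nearby hδ y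
    exact (hxy p hp r hr).trans (hyz r hr q hq)
  · intro x y _ _ hxy p hp q hq
    exact (hxy q hq p hp).symm

lemma disjoint_discretize {δ : ℝ} {K M : Set (ℝ × ℝ)}
    (h : ∀ x ∈ K, ∀ y ∈ M, 2 * δ < dist x y) : Disjoint (discretize δ K) (discretize δ M) := by
  rw [Set.disjoint_left]
  intro p hp hq
  simp only [discretize, Set.mem_iUnion, exists_prop] at hp hq
  obtain ⟨x, hx, hp⟩ := hp
  obtain ⟨y, hy, hq⟩ := hq
  refine (h x hx y hy).not_ge ?_
  rw [Prod.dist_eq, max_le_iff, Real.dist_eq, Real.dist_eq]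
  have h1 := abs_sub_le x.1 (δ * p.1) y.1
  have h2 := abs_sub_le x.2 (δ * p.2) y.2
  rw [abs_sub_comm (δ * _)] at h1 h2
  constructor
  · linarith [hp.1, hq.1]
  · linarith [hp.2, hq.2]

lemma eventually_separated {K M : Set (ℝ × ℝ)} (hK : IsCompact K) (hM : IsCompact M)
    (h : Disjoint K M) : ∀ᶠ δ : ℝ in 𝓝[>] 0, ∀ x ∈ K, ∀ y ∈ M, 2 * δ < dist x y := by
  obtain ⟨r, hr, hrKM⟩ := Metric.exists_pos_forall_lt_edist hK hM.isClosed h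
  have hr2 : (0 : ℝ) < r / 2 := half_pos (by exact_mod_cast hr)
  filter_upwards [mem_nhdsWithin_of_mem_nhds (Iio_mem_nhds hr2)] with δ hδ x hx y hy
  have h1 := hrKM x hx y hy
  rw [edist_nndist, ENNReal.coe_lt_coe] at h1
  have h2 : (r : ℝ) < dist x y := by exact_mod_cast h1
  have h3 : δ < r / 2 := hδ
  linarith

lemma eventually_discretize_subset_box {δ : ℝ} (hδ : 0 < δ) {K : Set (ℝ × ℝ)}
    (hK : Bornology.IsBounded K) : ∀ᶠ n : ℤ in atTop, discretize δ K ⊆ box n := by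
  obtain ⟨R, hR⟩ := hK.subset_closedBall 0
  filter_upwards [eventually_ge_atTop ⌈R / δ + 1⌉] with n hn p hp
  simp only [discretize, Set.mem_iUnion, exists_prop] at hp
  obtain ⟨x, hx, hp⟩ := hp
  have hxR := hR hx
  rw [Metric.mem_closedBall, Prod.dist_eq, max_le_iff, Real.dist_eq, Real.dist_eq, Prod.fst_zero,
    Prod.snd_zero, sub_zero, sub_zero] at hxR
  have hn' : R + δ ≤ δ * n := by
    have h1 := Int.ceil_le.1 hn
    calc R + δ = δ * (R / δ + 1) := by field_simp
      _ ≤ δ * n := mul_le_mul_of_nonneg_left h1 hδ.le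
  have key : ∀ (s : ℝ) (k : ℤ), |s| ≤ R → |s - δ * k| ≤ δ → -n ≤ k ∧ k ≤ n := by
    intro s k hs hk
    rw [abs_le] at hs hk
    constructor
    · have : δ * ((-n : ℤ) : ℝ) ≤ δ * k := by
        push_cast
        linarith
      exact_mod_cast le_of_mul_le_mul_left this hδ
    · have : δ * (k : ℝ) ≤ δ * n := by linarith
      exact_mod_cast le_of_mul_le_mul_left this hδ
  exact mem_box.2 ⟨key _ _ hxR.1 hp.1, key _ _ hxR.2 hp.2⟩

end Discretization

section Drawing

open Filter Topology Set

variable {X : Type*} [TopologicalSpace X] {G : SimpleGraph V}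

/-- The part of the arc from `u` to `v` with parameters in `I`; empty if there is no such edge. -/
def arcPart (D : GraphEmbeddingIn X G) (u v : V) (I : Set ℝ) : Set X :=
  ⋃ h : G.Adj u v, D.edgeArc u v h '' I

lemma mem_arcPart {D : GraphEmbeddingIn X G} {u v : V} {I : Set ℝ} {x : X} :
    x ∈ arcPart D u v I ↔ ∃ h : G.Adj u v, ∃ t ∈ I, D.edgeArc u v h t = x := by
  simp [arcPart]

lemma isCompact_arcPart (D : GraphEmbeddingIn X G) (u v : V) {a b : ℝ} (ha : 0 ≤ a) (hb : b ≤ 1) :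
    IsCompact (arcPart D u v (Icc a b)) :=
  isCompact_iUnion fun h => isCompact_Icc.image_of_continuousOn
    ((D.arc_cont u v h).mono (Icc_subset_Icc ha hb))

lemma isPreconnected_arcPart (D : GraphEmbeddingIn X G) (u v : V) {a b : ℝ} (ha : 0 ≤ a)
    (hb : b ≤ 1) : IsPreconnected (arcPart D u v (Icc a b)) := by
  by_cases h : G.Adj u v
  · have : arcPart D u v (Icc a b) = D.edgeArc u v h '' Icc a b := by simp [arcPart, h]
    rw [this]
    exact isPreconnected_Icc.image _ ((D.arc_cont u v h).mono (Icc_subset_Icc ha hb))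
  · simp [arcPart, h, isPreconnected_empty]

variable [LinearOrder V]

lemma eq_of_edgeArc_eq (D : GraphEmbeddingIn X G) {u v u' v' : V} {h : G.Adj u v}
    {h' : G.Adj u' v'} (huv : u < v) (huv' : u' < v') {t t' : ℝ} (ht : t ∈ Ioo (0 : ℝ) 1)
    (ht' : t' ∈ Icc (0 : ℝ) 1) (he : D.edgeArc u v h t = D.edgeArc u' v' h' t') :
    u = u' ∧ v = v' ∧ t = t' := by
  by_cases hs : s(u, v) = s(u', v')
  · rcases Sym2.eq_iff.1 hs with ⟨rfl, rfl⟩ | ⟨rfl, rfl⟩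
    · exact ⟨rfl, rfl, D.arc_injOn _ _ _ (Ioo_subset_Icc_self ht) ht' he⟩
    · exact absurd huv huv'.not_gt
  · have hmem : D.edgeArc u v h t ∈
        D.edgeArc u v h '' Ioo 0 1 ∩ D.edgeArc u' v' h' '' Icc 0 1 :=
      ⟨mem_image_of_mem _ ht, he ▸ mem_image_of_mem _ ht'⟩
    rw [D.arc_disjoint u v h u' v' h' hs] at hmem
    exact hmem.elim

/-- A vertex together with the adjacent thirds of its incident arcs. -/
def vertexStar (D : GraphEmbeddingIn X G) (v : V) : Set X :=
  {D.vertexPos v} ∪ ((⋃ w ∈ Ioi v, arcPart D v w (Icc 0 (1 / 3))) ∪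
    ⋃ w ∈ Iio v, arcPart D w v (Icc (2 / 3) 1))

lemma isCompact_vertexStar [Finite V] (D : GraphEmbeddingIn X G) (v : V) :
    IsCompact (vertexStar D v) :=
  isCompact_singleton.union (((toFinite _).isCompact_biUnion fun w _ =>
    isCompact_arcPart D v w le_rfl (by norm_num)).union ((toFinite _).isCompact_biUnion fun w _ =>
    isCompact_arcPart D w v (by norm_num) le_rfl))

lemma vertexPos_mem_vertexStar (D : GraphEmbeddingIn X G) (v : V) :
    D.vertexPos v ∈ vertexStar D v :=
  Or.inl rfl

lemma left_arcPart_subset_vertexStar (D : GraphEmbeddingIn X G) {v w : V} (h : v < w) :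
    arcPart D v w (Icc 0 (1 / 3)) ⊆ vertexStar D v := fun _ hx =>
  Or.inr (Or.inl (mem_biUnion (x := w) h hx))

lemma right_arcPart_subset_vertexStar (D : GraphEmbeddingIn X G) {v w : V} (h : w < v) :
    arcPart D w v (Icc (2 / 3) 1) ⊆ vertexStar D v := fun _ hx =>
  Or.inr (Or.inr (mem_biUnion (x := w) h hx))

lemma isPreconnected_vertexStar (D : GraphEmbeddingIn X G) (v : V) :
    IsPreconnected (vertexStar D v) := by
  refine isPreconnected_of_forall (D.vertexPos v) fun y hy => ?_
  rcases id hy with hy' | hy' | hy'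
  · exact ⟨{D.vertexPos v}, subset_union_left, rfl, hy', isPreconnected_singleton⟩
  · simp only [mem_iUnion, exists_prop] at hy'
    obtain ⟨w, hw, hy'⟩ := hy'
    obtain ⟨h, -⟩ := mem_arcPart.1 hy'
    exact ⟨_, left_arcPart_subset_vertexStar D hw,
      mem_arcPart.2 ⟨h, 0, by norm_num, D.arc_start v w h⟩, hy',
      isPreconnected_arcPart D v w le_rfl (by norm_num)⟩
  · simp only [mem_iUnion, exists_prop] at hy'
    obtain ⟨w, hw, hy'⟩ := hy'
    obtain ⟨h, -⟩ := mem_arcPart.1 hy'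
    exact ⟨_, right_arcPart_subset_vertexStar D hw,
      mem_arcPart.2 ⟨h, 1, by norm_num, D.arc_end w v h⟩, hy',
      isPreconnected_arcPart D w v (by norm_num) le_rfl⟩

lemma exists_of_mem_vertexStar {D : GraphEmbeddingIn X G} {v : V} {x : X}
    (hx : x ∈ vertexStar D v) :
    x = D.vertexPos v ∨ ∃ a b, ∃ h : G.Adj a b, ∃ t ∈ Ioo (0 : ℝ) 1, a < b ∧
      D.edgeArc a b h t = x ∧ (a = v ∧ t ≤ 1 / 3 ∨ b = v ∧ 2 / 3 ≤ t) := by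
  rcases hx with hx | hx | hx
  · exact Or.inl hx
  · simp only [mem_iUnion, exists_prop] at hx
    obtain ⟨w, hw, hx⟩ := hx
    obtain ⟨h, t, ht, rfl⟩ := mem_arcPart.1 hx
    rcases ht.1.eq_or_lt with rfl | h0
    · exact Or.inl (D.arc_start v w h)
    · exact Or.inr ⟨v, w, h, t, ⟨h0, by linarith [ht.2]⟩, hw, rfl, Or.inl ⟨rfl, ht.2⟩⟩
  · simp only [mem_iUnion, exists_prop] at hx
    obtain ⟨w, hw, hx⟩ := hx
    obtain ⟨h, t, ht, rfl⟩ := mem_arcPart.1 hx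
    rcases ht.2.eq_or_lt with rfl | h0
    · exact Or.inl (D.arc_end w v h)
    · exact Or.inr ⟨w, v, h, t, ⟨by linarith [ht.1], h0⟩, hw, rfl, Or.inr ⟨rfl, ht.1⟩⟩

lemma disjoint_vertexStar (D : GraphEmbeddingIn X G) {u v : V} (huv : u ≠ v) :
    Disjoint (vertexStar D u) (vertexStar D v) := by
  rw [Set.disjoint_left]
  intro x hu hv
  rcases exists_of_mem_vertexStar hu with rfl | ⟨a, b, h, t, ht, hab, rfl, hat⟩
  · rcases exists_of_mem_vertexStar hv with hx | ⟨a, b, h, t, ht, hab, hx, -⟩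
    · exact huv (D.vertexInj hx)
    · exact D.arc_avoid a b h u ⟨t, ht, hx⟩
  · rcases exists_of_mem_vertexStar hv with hx | ⟨a', b', h', t', ht', hab', hx, hat'⟩
    · exact D.arc_avoid a b h v ⟨t, ht, hx⟩
    · obtain ⟨rfl, rfl, rfl⟩ := eq_of_edgeArc_eq D hab hab' ht (Ioo_subset_Icc_self ht') hx.symm
      rcases hat with ⟨rfl, h1⟩ | ⟨rfl, h1⟩ <;> rcases hat' with ⟨h2, h3⟩ | ⟨h2, h3⟩
      · exact huv h2
      · linarith
      · linarith
      · exact huv h2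

lemma disjoint_arcPart_vertexStar (D : GraphEmbeddingIn X G) {u v w : V} (huv : u < v)
    (hwu : w ≠ u) (hwv : w ≠ v) :
    Disjoint (arcPart D u v (Icc (1 / 3) (2 / 3))) (vertexStar D w) := by
  rw [Set.disjoint_left]
  intro x hx hw
  obtain ⟨h, t, ht, rfl⟩ := mem_arcPart.1 hx
  have ht' : t ∈ Ioo (0 : ℝ) 1 := ⟨by linarith [ht.1], by linarith [ht.2]⟩
  rcases exists_of_mem_vertexStar hw with hx | ⟨a, b, h', s, hs, hab, hx, has⟩
  · exact D.arc_avoid u v h w ⟨t, ht', hx⟩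
  · obtain ⟨rfl, rfl, -⟩ := eq_of_edgeArc_eq D huv hab ht' (Ioo_subset_Icc_self hs) hx.symm
    rcases has with ⟨h1, -⟩ | ⟨h1, -⟩
    · exact hwu h1.symm
    · exact hwv h1.symm

lemma disjoint_arcPart_arcPart (D : GraphEmbeddingIn X G) {u v u' v' : V} (huv : u < v)
    (huv' : u' < v') (hne : u ≠ u') :
    Disjoint (arcPart D u v (Icc (1 / 3) (2 / 3))) (arcPart D u' v' (Icc (1 / 3) (2 / 3))) := by
  rw [Set.disjoint_left]
  intro x hx hx'
  obtain ⟨h, t, ht, rfl⟩ := mem_arcPart.1 hx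
  obtain ⟨h', t', ht', he⟩ := mem_arcPart.1 hx'
  exact hne (eq_of_edgeArc_eq D huv huv' ⟨by linarith [ht.1], by linarith [ht.2]⟩
    ⟨by linarith [ht'.1], by linarith [ht'.2]⟩ he.symm).1

end Drawing

lemma hasDual_of_isPlanar [Fintype V] {G : SimpleGraph V} (hG : G.IsPlanar) : HasDual G := by
  obtain ⟨D⟩ := hG
  let _ : LinearOrder V := LinearOrder.lift' (Fintype.equivFin V) (Fintype.equivFin V).injective
  let M : V → V → Set (ℝ × ℝ) := fun u v => arcPart D u v (Set.Icc (1 / 3) (2 / 3))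
  have hK := isCompact_vertexStar D
  have hM : ∀ u v, IsCompact (M u v) := fun u v =>
    isCompact_arcPart D u v (by norm_num) (by norm_num)
  have hsep : ∀ᶠ δ : ℝ in nhdsWithin 0 (Set.Ioi 0), 0 < δ ∧
      (∀ u v, u ≠ v → ∀ x ∈ vertexStar D u, ∀ y ∈ vertexStar D v, 2 * δ < dist x y) ∧
      (∀ u v w, u < v → w ≠ u → w ≠ v → ∀ x ∈ M u v, ∀ y ∈ vertexStar D w, 2 * δ < dist x y) ∧
      ∀ u v u' v', u < v → u' < v' → u ≠ u' → ∀ x ∈ M u v, ∀ y ∈ M u' v', 2 * δ < dist x y := by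
    refine Filter.Eventually.and self_mem_nhdsWithin (.and ?_ (.and ?_ ?_))
    · simp only [Filter.eventually_all]
      exact fun u v h => eventually_separated (hK u) (hK v) (disjoint_vertexStar D h)
    · simp only [Filter.eventually_all]
      exact fun u v w h h1 h2 => eventually_separated (hM u v) (hK w)
        (disjoint_arcPart_vertexStar D h h1 h2)
    · simp only [Filter.eventually_all]
      exact fun u v u' v' h h' h1 => eventually_separated (hM u v) (hM u' v')
        (disjoint_arcPart_arcPart D h h' h1)
  obtain ⟨δ, hδ, hKK, hMK, hMM⟩ := hsep.exists
  have hbox : ∀ᶠ n : ℤ in Filter.atTop, 0 ≤ n ∧ (∀ v, discretize δ (vertexStar D v) ⊆ box n) ∧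
      ∀ u v, discretize δ (M u v) ⊆ box n := by
    refine (Filter.eventually_ge_atTop 0).and (.and ?_ ?_) <;> simp only [Filter.eventually_all]
    · exact fun v => eventually_discretize_subset_box hδ (hK v).isBounded
    · exact fun u v => eventually_discretize_subset_box hδ (hM u v).isBounded
  obtain ⟨n, hn, hKbox, hMbox⟩ := hbox.exists
  have hinter : ∀ {K K' : Set (ℝ × ℝ)} {x : ℝ × ℝ}, x ∈ K → x ∈ K' →
      (discretize δ K ∩ discretize δ K').Nonempty := by
    intro K K' x hx hx'
    obtain ⟨p, hp, -⟩ := exists_mem_nearby hδ x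
    exact ⟨p, nearby_subset_discretize hx hp, nearby_subset_discretize hx' hp⟩
  refine hasDual_of_lattice_model hn hKbox hMbox
    (fun v => (hinter (vertexPos_mem_vertexStar D v) (vertexPos_mem_vertexStar D v)).left)
    (fun v p hp q hq => discretize_reachable hδ (isPreconnected_vertexStar D v) hp hq)
    (fun u v p hp q hq => discretize_reachable hδ
      (isPreconnected_arcPart D u v (by norm_num) (by norm_num)) hp hq)
    (fun u v h => disjoint_discretize (hKK u v h))
    (fun u v w h h1 h2 => disjoint_discretize (hMK u v w h h1 h2))
    (fun u v u' v' h h' h1 => disjoint_discretize (hMM u v u' v' h h' h1))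
    (fun u v huv h => ⟨hinter (x := D.edgeArc u v h (1 / 3)) ?_ ?_,
      hinter (x := D.edgeArc u v h (2 / 3)) ?_ ?_⟩)
  · exact mem_arcPart.2 ⟨h, _, by norm_num, rfl⟩
  · exact left_arcPart_subset_vertexStar D huv (mem_arcPart.2 ⟨h, _, by norm_num, rfl⟩)
  · exact mem_arcPart.2 ⟨h, _, by norm_num, rfl⟩
  · exact right_arcPart_subset_vertexStar D huv (mem_arcPart.2 ⟨h, _, by norm_num, rfl⟩)

end Grotzsch

/-- If deleting an edge of `H` yields a planar triangle-free graph, then `H` is 3-colorable. -/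
theorem three_colorable_of_deleteEdge_planar_triangleFree [Fintype V] (H : SimpleGraph V)
    (h : Sym2 V) (hh : h ∈ H.edgeSet)
    (hplanar : (H.deleteEdges {h}).IsPlanar)
    (htf : (H.deleteEdges {h}).CliqueFree 3) : H.Colorable 3 := by
  classical
  induction h using Sym2.ind with
  | _ a b =>
    have hG : Grotzsch.TriFree (H.deleteEdges {s(a, b)}) := fun x y z hxy hyz hzx =>
      htf {x, y, z} (SimpleGraph.is3Clique_triple_iff.2 ⟨hxy, hzx.symm, hyz⟩)
    obtain ⟨c, hc, hk⟩ := Grotzsch.exists_coloring_ne_of_hasDual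
      (Grotzsch.hasDual_of_isPlanar hplanar) hG (SimpleGraph.Adj.ne (G := H) hh)
    refine ⟨SimpleGraph.Coloring.mk c fun {x y} hxy => ?_⟩
    by_cases he : s(x, y) = s(a, b)
    · rcases Sym2.eq_iff.1 he with ⟨rfl, rfl⟩ | ⟨rfl, rfl⟩
      · exact hk
      · exact hk.symm
    · exact hc x y (SimpleGraph.deleteEdges_adj.2 ⟨hxy, he⟩)
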